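/- arXiv:1701.00927 — 5 statements merged into one kernel-verified Lean document; each statement's English description precedes it below -/
import Mathlib

section
/- Every finite simple bipartite graph with minimum degree at least 3 has the {a,b}-property for every pair of non-negative integers a and b of distinct parity. -/
open scoped Classical

/-- The weighted degree of vertex `v` under edge-weighting `w`:
the sum of the weights of the edges incident with `v`. -/
noncomputable def wdeg {V : Type} [Fintype V] (G : SimpleGraph V) (w : Sym2 V → ℕ) (v : V) : ℕ :=
  ∑ u ∈ Finset.univ.filter (fun u => G.Adj v u), w s(v, u)

/-- `w` is a `{0,1}`-weighting of `G`: every edge gets weight `0` or `1`. -/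
def Is01Weighting {V : Type} (G : SimpleGraph V) (w : Sym2 V → ℕ) : Prop :=
  ∀ e ∈ G.edgeSet, w e = 0 ∨ w e = 1

/-- `G` has the `{0,1}`-property: it admits a proper (neighbour sum-distinguishing)
`{0,1}`-edge-weighting. A graph without this property is called *bad*. -/
def HasZeroOneProperty {V : Type} [Fintype V] (G : SimpleGraph V) : Prop :=
  ∃ w : Sym2 V → ℕ, Is01Weighting G w ∧
    ∀ ⦃u v : V⦄, G.Adj u v → wdeg G w u ≠ wdeg G w v
/-- Integer-valued weighted degree. -/
noncomputable def wdegZ {V : Type} [Fintype V] (G : SimpleGraph V) (w : Sym2 V → ℤ) (v : V) : ℤ :=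
  ∑ u ∈ Finset.univ.filter (fun u => G.Adj v u), w s(v, u)

/-- `G` has the `{a,b}`-property: there is an edge-weighting with values in `{a,b}` under
which adjacent vertices get distinct weighted degrees. -/
def HasABProperty {V : Type} [Fintype V] (G : SimpleGraph V) (a b : ℤ) : Prop :=
  ∃ w : Sym2 V → ℤ, (∀ e ∈ G.edgeSet, w e = a ∨ w e = b) ∧
    ∀ ⦃u v : V⦄, G.Adj u v → wdegZ G w u ≠ wdegZ G w v

section ParityJoins

variable {V : Type} {G : SimpleGraph V}

/-- The edge function `c` is supported on the edges of `G` inside `K`. -/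
def SuppIn (G : SimpleGraph V) (K : Finset V) (c : Sym2 V → ZMod 2) : Prop :=
  ∀ p q, c s(p, q) ≠ 0 → G.Adj p q ∧ p ∈ K ∧ q ∈ K

lemma SuppIn.mono {K L : Finset V} {c : Sym2 V → ZMod 2} (h : SuppIn G K c) (hKL : K ⊆ L) :
    SuppIn G L c := fun p q hpq =>
  ⟨(h p q hpq).1, hKL (h p q hpq).2.1, hKL (h p q hpq).2.2⟩

lemma SuppIn.zero (K : Finset V) : SuppIn G K 0 := fun _ _ h => absurd rfl h

lemma SuppIn.add {K : Finset V} {c d : Sym2 V → ZMod 2} (hc : SuppIn G K c)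
    (hd : SuppIn G K d) : SuppIn G K (c + d) := by
  intro p q h
  by_cases h0 : c s(p, q) = 0
  · refine hd p q fun h1 => h ?_
    simp [h0, h1]
  · exact hc p q h0

lemma SuppIn.sum {ι : Type} {K : Finset V} (s : Finset ι) {c : ι → Sym2 V → ZMod 2}
    (h : ∀ i ∈ s, SuppIn G K (c i)) : SuppIn G K (∑ i ∈ s, c i) := by
  intro p q hpq
  rw [Finset.sum_apply] at hpq
  obtain ⟨i, hi, hne⟩ := Finset.exists_ne_zero_of_sum_ne_zero hpq
  exact h i hi p q hne

lemma add_self_zmod_two (z : ZMod 2) : z + z = 0 := CharTwo.add_self_eq_zero z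

lemma suppIn_edge {K : Finset V} {x y : V} (hxy : G.Adj x y) (hx : x ∈ K) (hy : y ∈ K) :
    SuppIn G K (fun e => if e = s(x, y) then (1 : ZMod 2) else 0) := by
  intro p q h
  have : s(p, q) = s(x, y) := by
    by_contra h'
    simp [h'] at h
  rcases Sym2.eq_iff.1 this with ⟨rfl, rfl⟩ | ⟨rfl, rfl⟩
  · exact ⟨hxy, hx, hy⟩
  · exact ⟨hxy.symm, hy, hx⟩

lemma SuppIn.diag {K : Finset V} {c : Sym2 V → ZMod 2} (hc : SuppIn G K c) (p : V) :
    c s(p, p) = 0 := by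
  by_contra h
  exact (hc p p h).1.ne rfl

variable [Fintype V]

/-- The boundary of a `ZMod 2`-valued edge function. -/
noncomputable def bdry (c : Sym2 V → ZMod 2) (v : V) : ZMod 2 := ∑ w, c s(v, w)

/-- Any two vertices of `K` form the boundary of an edge function supported inside `K`.
This holds exactly when `K` induces a preconnected subgraph. -/
def Linked (G : SimpleGraph V) (K : Finset V) : Prop :=
  ∀ x ∈ K, ∀ y ∈ K, ∃ c, SuppIn G K c ∧
    ∀ p, bdry c p = (if p = x then 1 else 0) + (if p = y then 1 else 0)

lemma bdry_zero (p : V) : bdry (0 : Sym2 V → ZMod 2) p = 0 := by simp [bdry]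

lemma bdry_add (c d : Sym2 V → ZMod 2) (p : V) : bdry (c + d) p = bdry c p + bdry d p := by
  simp [bdry, Finset.sum_add_distrib]

lemma bdry_sum {ι : Type} (s : Finset ι) (c : ι → Sym2 V → ZMod 2) (p : V) :
    bdry (∑ i ∈ s, c i) p = ∑ i ∈ s, bdry (c i) p := by
  simp only [bdry, Finset.sum_apply]
  exact Finset.sum_comm

lemma bdry_edge {x y : V} (hxy : x ≠ y) (p : V) :
    bdry (fun e => if e = s(x, y) then (1 : ZMod 2) else 0) p =
      (if p = x then 1 else 0) + (if p = y then 1 else 0) := by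
  unfold bdry
  by_cases hx : p = x
  · subst hx
    simp [hxy]
  · by_cases hy : p = y
    · subst hy
      have : ∀ w, (s(p, w) = s(x, p)) ↔ w = x := fun w => by
        rw [Sym2.eq_swap (a := x) (b := p)]; simp [hx]
      simp [this, hx]
    · have : ∀ w, s(p, w) ≠ s(x, y) := fun w => by simp [hx, hy]
      simp [this, hx, hy]

lemma linked_of_root {K : Finset V} (x : V)
    (h : ∀ y ∈ K, ∃ c, SuppIn G K c ∧
      ∀ p, bdry c p = (if p = x then 1 else 0) + (if p = y then 1 else 0)) : Linked G K := by
  intro y hy z hz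
  obtain ⟨c, hc, hc'⟩ := h y hy
  obtain ⟨d, hd, hd'⟩ := h z hz
  refine ⟨c + d, hc.add hd, fun p => ?_⟩
  rw [bdry_add, hc', hd']
  linear_combination add_self_zmod_two (if p = x then 1 else 0)

lemma linked_singleton (x : V) : Linked G {x} := by
  refine linked_of_root x fun y hy => ⟨0, SuppIn.zero _, fun p => ?_⟩
  rw [Finset.mem_singleton.1 hy, bdry_zero, add_self_zmod_two]

lemma exists_bdry_of_adj {K : Finset V} {x y z : V} (hyz : G.Adj y z) (hy : y ∈ K) (hz : z ∈ K)
    (h : ∃ c, SuppIn G K c ∧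
      ∀ p, bdry c p = (if p = x then 1 else 0) + (if p = y then 1 else 0)) :
    ∃ c, SuppIn G K c ∧
      ∀ p, bdry c p = (if p = x then 1 else 0) + (if p = z then 1 else 0) := by
  obtain ⟨c, hc, hc'⟩ := h
  refine ⟨c + _, hc.add (suppIn_edge hyz hy hz), fun p => ?_⟩
  rw [bdry_add, hc', bdry_edge hyz.ne]
  linear_combination add_self_zmod_two (if p = y then 1 else 0)

lemma Linked.insert {K : Finset V} (hK : Linked G K) {x y : V} (hx : x ∈ K) (hxy : G.Adj x y) :
    Linked G (insert y K) := by
  refine linked_of_root x fun z hz => ?_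
  have key : ∀ w ∈ K, ∃ c, SuppIn G (Insert.insert y K) c ∧
      ∀ p, bdry c p = (if p = x then 1 else 0) + (if p = w then 1 else 0) := fun w hw => by
    obtain ⟨c, hc, hc'⟩ := hK x hx w hw
    exact ⟨c, hc.mono (Finset.subset_insert _ _), hc'⟩
  rcases Finset.mem_insert.1 hz with rfl | hz
  · exact exists_bdry_of_adj hxy (Finset.mem_insert_of_mem hx) (Finset.mem_insert_self _ _)
      (key x hx)
  · exact key z hz

lemma linked_reachable (r : V) : Linked G (Finset.univ.filter (G.Reachable r)) := by
  refine linked_of_root r fun y hy => ?_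
  have hy' : Relation.ReflTransGen G.Adj r y := by
    rw [← SimpleGraph.reachable_iff_reflTransGen]
    simpa using hy
  clear hy
  induction hy' with
  | refl =>
    exact ⟨0, SuppIn.zero _, fun p => by rw [bdry_zero, add_self_zmod_two]⟩
  | @tail b c hb hbc ih =>
    have hb' : G.Reachable r b := by rwa [SimpleGraph.reachable_iff_reflTransGen]
    exact exists_bdry_of_adj hbc (by simpa using hb') (by simpa using hb'.trans hbc.reachable) ih

/-- The handshake lemma for edge functions without support on the cut around `K`. -/
lemma sum_bdry_eq_zero {K : Finset V} {c : Sym2 V → ZMod 2} (hd : ∀ p, c s(p, p) = 0)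
    (h : ∀ p ∈ K, ∀ q ∉ K, c s(p, q) = 0) : ∑ p ∈ K, bdry c p = 0 := by
  have h1 : ∀ p ∈ K, bdry c p = ∑ q ∈ K, c s(p, q) := fun p hp => by
    unfold bdry
    exact (Finset.sum_subset (Finset.subset_univ K) fun q _ hq => h p hp q hq).symm
  rw [Finset.sum_congr rfl h1, ← Finset.sum_product']
  refine Finset.sum_involution (fun pq _ => (pq.2, pq.1)) ?_ ?_ ?_ ?_
  · rintro ⟨p, q⟩ _
    rw [Sym2.eq_swap (a := q)]
    exact add_self_zmod_two _
  · rintro ⟨p, q⟩ _ hne heq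
    have : q = p := (Prod.ext_iff.1 heq).1
    subst this
    exact hne (hd _)
  · rintro ⟨p, q⟩ hpq
    simp only [Finset.mem_product] at hpq ⊢
    exact hpq.symm
  · rintro ⟨p, q⟩ _
    rfl

lemma Linked.exists_adj_of_ssubset {S K : Finset V} (hS : Linked G S) {x y : V} (hx : x ∈ K)
    (hxS : x ∈ S) (hy : y ∉ K) (hyS : y ∈ S) : ∃ p ∈ K, ∃ q ∉ K, q ∈ S ∧ G.Adj p q := by
  by_contra! hno
  obtain ⟨c, hc, hc'⟩ := hS x hxS y hyS
  have h0 : ∑ p ∈ K, bdry c p = 0 := sum_bdry_eq_zero hc.diag fun p hp q hq => by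
    by_contra hne
    exact hno p hp q hq (hc p q hne).2.2 (hc p q hne).1
  simp [hc', Finset.sum_add_distrib, hx, hy] at h0

/-- In a linked set every function of total zero is a boundary. -/
lemma Linked.exists_join {K : Finset V} (hK : Linked G K) (τ : V → ZMod 2)
    (hτ : ∑ p ∈ K, τ p = 0) :
    ∃ c, SuppIn G K c ∧ ∀ p, bdry c p = if p ∈ K then τ p else 0 := by
  rcases K.eq_empty_or_nonempty with rfl | ⟨r, hr⟩
  · exact ⟨0, SuppIn.zero _, fun p => by simp [bdry_zero]⟩
  choose! c hc hc' using hK r hr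
  refine ⟨∑ y ∈ K, (if τ y = 0 then 0 else c y), SuppIn.sum _ fun y hy => ?_, fun p => ?_⟩
  · split_ifs
    · exact SuppIn.zero _
    · exact hc y hy
  · rw [bdry_sum]
    have h1 : ∀ y ∈ K, bdry (if τ y = 0 then 0 else c y) p =
        τ y * (if p = r then 1 else 0) + (if p = y then τ y else 0) := fun y hy => by
      have h2 : τ y = 0 ∨ τ y = 1 := by
        generalize τ y = z
        revert z; decide
      rcases h2 with h2 | h2
      · simp [h2, bdry_zero]
      · simp [h2, hc' y hy]
    rw [Finset.sum_congr rfl h1, Finset.sum_add_distrib, ← Finset.sum_mul, hτ]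
    simp

/-- A prescription of an edge function off a linked set `K` can be completed inside `K`. -/
lemma Linked.exists_completion {K S : Finset V} (hK : Linked G K) (hKS : K ⊆ S)
    {c₀ : Sym2 V → ZMod 2} (hc₀ : SuppIn G S c₀) {τ : V → ZMod 2} (hτ : ∑ p ∈ S, τ p = 0)
    (h : ∀ p ∈ S, p ∉ K → bdry c₀ p = τ p) :
    ∃ c, SuppIn G S c ∧ (∀ p ∉ K, ∀ q, c s(p, q) = c₀ s(p, q)) ∧ ∀ p ∈ S, bdry c p = τ p := by
  have h0 : ∑ p ∈ S, bdry c₀ p = 0 := sum_bdry_eq_zero hc₀.diag fun p _ q hq => by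
    by_contra hne
    exact hq (hc₀ p q hne).2.2
  have h1 : ∑ p ∈ K, (τ p - bdry c₀ p) = 0 := by
    rw [Finset.sum_subset hKS fun p hp hpK => by rw [h p hp hpK, sub_self],
      Finset.sum_sub_distrib, hτ, h0, sub_zero]
  obtain ⟨d, hd, hd'⟩ := hK.exists_join _ h1
  refine ⟨c₀ + d, hc₀.add (hd.mono hKS), fun p hp q => ?_, fun p hp => ?_⟩
  · have : d s(p, q) = 0 := by
      by_contra hne
      exact hp (hd p q hne).2.1
    simp [this]
  · rw [bdry_add, hd']
    split_ifs with hpK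
    · ring
    · rw [h p hp hpK, add_zero]

end ParityJoins

/-- `col` assigns to each `u ∈ U` a column `col u ⊆ X`, prescribing which edges between `u` and `X`
get the odd weight. All rows other than that of `v` have the parity opposite to `e`, the row of `v`
has parity `e`, and no column completed to parity `e` by at most one further edge gives the value
`Δ u` after comparison with the row of `v`. -/
structure IsColumnChoice {α : Type} (X U : Finset α) (v : α) (Δ : α → ℤ) (β : ℤ) (e : ℕ)
    (col : α → Finset α) : Prop where
  subset : ∀ u, col u ⊆ X
  row : ∀ x ∈ X, x ≠ v → (U.filter (fun u => x ∈ col u)).card % 2 = (e + 1) % 2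
  row_self : (U.filter (fun u => v ∈ col u)).card % 2 = e % 2
  ne : ∀ u ∈ U, ∀ f : ℕ, f = (col u).card ∨ f = (col u).card + 1 → f % 2 = e % 2 →
    β * ((f : ℤ) - ((U.filter (fun u => v ∈ col u)).card : ℤ)) ≠ Δ u

lemma exists_isColumnChoice {α : Type} {X U : Finset α} {v : α} (hv : v ∈ X) (hX : 2 ≤ X.card)
    (hU : 3 ≤ U.card) (Δ : α → ℤ) {β : ℤ} (hβ : β ≠ 0) :
    ∃ (e : ℕ) (col : α → Finset α), IsColumnChoice X U v Δ β e col := by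
  have hXv : (X.erase v).card = X.card - 1 := Finset.card_erase_of_mem hv
  set M : ℕ := (X.card - 1) + (X.card - 1) % 2 with hM
  have caseOdd : ∀ P ⊆ U, P.card % 2 = 1 → (∀ u ∈ U, Δ u = 0 → u ∈ P) →
      (∀ u ∈ P, Δ u ≠ β * M) →
      ∃ (e : ℕ) (col : α → Finset α), IsColumnChoice X U v Δ β e col := fun P hPU hPodd hP0 hPM => by
    refine ⟨0, fun u => if u ∈ P then X.erase v else ∅, fun u => ?_, fun x hx hxv => ?_, ?_, ?_⟩
    · split_ifs
      · exact Finset.erase_subset _ _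
      · exact Finset.empty_subset _
    · have : U.filter (fun u => x ∈ (if u ∈ P then X.erase v else ∅)) = P := by
        ext u
        by_cases hu : u ∈ P <;> simp [hu, hx, hxv]
        exact hPU hu
      rw [this, hPodd]
    · have : U.filter (fun u => v ∈ (if u ∈ P then X.erase v else ∅)) = ∅ := by
        ext u
        by_cases hu : u ∈ P <;> simp [hu]
      rw [this]; rfl
    · intro u hu f hf hf2
      have : U.filter (fun u => v ∈ (if u ∈ P then X.erase v else ∅)) = ∅ := by
        ext u
        by_cases hu : u ∈ P <;> simp [hu]
      rw [this]
      by_cases huP : u ∈ P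
      · rw [if_pos huP, hXv] at hf
        have hfM : f = M := by omega
        have := hPM u huP
        rw [hfM]
        simpa using this.symm
      · rw [if_neg huP, Finset.card_empty] at hf
        have hf0 : f = 0 := by omega
        have : Δ u ≠ 0 := fun h => huP (hP0 u hu h)
        rw [hf0]
        simpa using this.symm
  have hMpos : 0 < M := by omega
  have hβM : β * M ≠ 0 := mul_ne_zero hβ (by exact_mod_cast hMpos.ne')
  set P := U.filter (fun u => Δ u = 0) with hP
  by_cases hPodd : P.card % 2 = 1
  · refine caseOdd P (Finset.filter_subset _ _) hPodd (fun u hu h => by simp [hP, hu, h]) ?_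
    intro u hu h
    exact hβM (h ▸ (Finset.mem_filter.1 hu).2)
  by_cases hstar : ∃ u ∈ U, Δ u ≠ 0 ∧ Δ u ≠ β * M
  · obtain ⟨s, hs, hs0, hsM⟩ := hstar
    have hsP : s ∉ P := by simp [hP, hs0]
    refine caseOdd (insert s P) ?_ ?_ (fun u hu h => by simp [hP, hu, h]) ?_
    · exact Finset.insert_subset hs (Finset.filter_subset _ _)
    · rw [Finset.card_insert_of_notMem hsP]
      omega
    · intro u hu h
      rcases Finset.mem_insert.1 hu with rfl | hu
      · exact hsM h
      · exact hβM (h ▸ (Finset.mem_filter.1 hu).2)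
  push Not at hstar
  -- a count `f` at `u` can only be in conflict with the row `v` of full length in two ways
  have conflict : ∀ u ∈ U, ∀ f : ℕ, β * ((f : ℤ) - (U.card : ℤ)) = Δ u →
      (Δ u = 0 ∧ f = U.card) ∨ (Δ u = β * M ∧ f = U.card + M) := fun u hu f h => by
    by_cases h0 : Δ u = 0
    · left
      refine ⟨h0, ?_⟩
      rw [h0] at h
      have := (mul_eq_zero.1 h).resolve_left hβ
      omega
    · right
      refine ⟨hstar u hu h0, ?_⟩
      rw [hstar u hu h0] at h
      have := mul_left_cancel₀ hβ h
      omega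
  by_cases hn : U.card % 2 = 1
  · refine ⟨1, fun _ => {v}, fun u => by simpa using hv, fun x hx hxv => by simp [hxv],
      by simp [hn], fun u hu f hf hf2 h => ?_⟩
    simp only [Finset.mem_singleton, Finset.filter_true] at h
    rw [Finset.card_singleton] at hf
    rcases conflict u hu f h with ⟨_, h⟩ | ⟨_, h⟩ <;> omega
  by_cases hall : 3 ≤ X.card ∧ ∀ u ∈ U, Δ u = 0
  · obtain ⟨hX3, hall⟩ := hall
    obtain ⟨x₁, hx₁⟩ : (X.erase v).Nonempty := Finset.card_pos.1 (by omega)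
    obtain ⟨u₁, hu₁⟩ : U.Nonempty := Finset.card_pos.1 (by omega)
    have hx₁v : x₁ ≠ v := Finset.ne_of_mem_erase hx₁
    have hrow : U.filter (fun u => v ∈ (if u = u₁ then (X.erase v).erase x₁ else {x₁})) = ∅ := by
      ext u
      by_cases hu : u = u₁ <;> simp [hu, hx₁v.symm]
    refine ⟨0, fun u => if u = u₁ then (X.erase v).erase x₁ else {x₁}, fun u => ?_,
      fun x hx hxv => ?_, ?_, ?_⟩
    · split_ifs
      · exact (Finset.erase_subset _ _).trans (Finset.erase_subset _ _)
      · simpa using Finset.mem_of_mem_erase hx₁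
    · by_cases hxx : x = x₁
      · have : U.filter (fun u => x ∈ (if u = u₁ then (X.erase v).erase x₁ else {x₁})) =
            U.erase u₁ := by
          ext u
          by_cases hu : u = u₁ <;> simp [hu, hxx]
        rw [this, Finset.card_erase_of_mem hu₁]
        omega
      · have : U.filter (fun u => x ∈ (if u = u₁ then (X.erase v).erase x₁ else {x₁})) =
            {u₁} := by
          ext u
          by_cases hu : u = u₁ <;> simp [hu, hxx, hxv, hx, hu₁]
        rw [this, Finset.card_singleton]
    · rw [hrow]; rfl
    · intro u hu f hf hf2 h
      rw [hrow, hall u hu] at h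
      have hf0 : f ≠ 0 := by
        split_ifs at hf
        · rw [Finset.card_erase_of_mem hx₁, hXv] at hf
          omega
        · rw [Finset.card_singleton] at hf
          omega
      simp [hβ, hf0] at h
  obtain ⟨u₁, hu₁, hu₁'⟩ : ∃ u ∈ U, Δ u ≠ 0 ∨ X.card = 2 := by
    by_cases h2 : X.card = 2
    · obtain ⟨u₁, hu₁⟩ : U.Nonempty := Finset.card_pos.1 (by omega)
      exact ⟨u₁, hu₁, Or.inr h2⟩
    · by_contra! hcon
      exact hall ⟨by omega, fun u hu => (hcon u hu).1⟩
  have hrow : U.filter (fun u => v ∈ (if u = u₁ then X else {v})) = U := by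
    ext u
    by_cases hu : u = u₁ <;> simp [hu, hv]
  refine ⟨0, fun u => if u = u₁ then X else {v}, fun u => ?_, fun x hx hxv => ?_, ?_, ?_⟩
  · split_ifs
    · exact subset_rfl
    · simpa using hv
  · have : U.filter (fun u => x ∈ (if u = u₁ then X else {v})) = {u₁} := by
      ext u
      by_cases hu : u = u₁ <;> simp [hu, hx, hxv, hu₁]
    rw [this, Finset.card_singleton]
  · rw [hrow]; omega
  · intro u hu f hf hf2 h
    rw [hrow] at h
    split_ifs at hf with huu
    · subst huu
      rcases conflict u hu f h with ⟨h0, h⟩ | ⟨_, h⟩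
      · have := hu₁'.resolve_left (not_not.2 h0)
        omega
      · omega
    · rw [Finset.card_singleton] at hf
      rcases conflict u hu f h with ⟨_, h⟩ | ⟨_, h⟩ <;> omega

section Weightings

variable {V : Type} [Fintype V] {G : SimpleGraph V}

/-- The number of edges at `p` on which `c` does not vanish. -/
noncomputable def oddCount (c : Sym2 V → ZMod 2) (p : V) : ℕ :=
  (Finset.univ.filter (fun q => c s(p, q) ≠ 0)).card

/-- The weighting that is `a` where `c` vanishes and `b` elsewhere. -/
noncomputable def abWeight (a b : ℤ) (c : Sym2 V → ZMod 2) (e : Sym2 V) : ℤ :=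
  if c e = 0 then a else b

lemma bdry_eq_oddCount (c : Sym2 V → ZMod 2) (p : V) : bdry c p = oddCount c p := by
  unfold bdry oddCount
  rw [Finset.card_filter, Nat.cast_sum]
  refine Finset.sum_congr rfl fun q _ => ?_
  generalize c s(p, q) = z
  revert z
  decide

lemma wdegZ_abWeight {K : Finset V} {c : Sym2 V → ZMod 2} (hc : SuppIn G K c) (a b : ℤ) (p : V) :
    wdegZ G (abWeight a b c) p = a * G.degree p + (b - a) * oddCount c p := by
  unfold wdegZ oddCount
  have h1 : ∀ q ∈ Finset.univ.filter (fun q => G.Adj p q), abWeight a b c s(p, q) =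
      a + (b - a) * (if c s(p, q) ≠ 0 then 1 else 0) := fun q _ => by
    unfold abWeight
    by_cases h : c s(p, q) = 0 <;> simp [h]
  have h2 : (Finset.univ.filter (fun q => G.Adj p q)).filter (fun q => c s(p, q) ≠ 0) =
      Finset.univ.filter (fun q => c s(p, q) ≠ 0) := by
    ext q
    simpa using fun h => (hc p q h).1
  rw [Finset.sum_congr rfl h1, Finset.sum_add_distrib, ← Finset.mul_sum, Finset.sum_boole, h2,
    Finset.sum_const, ← SimpleGraph.neighborFinset_eq_filter,
    SimpleGraph.card_neighborFinset_eq_degree,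
    nsmul_eq_mul, mul_comm]

lemma wdegZ_abWeight_cast {K : Finset V} {c : Sym2 V → ZMod 2} (hc : SuppIn G K c) {a b : ℤ}
    (ha : (a : ZMod 2) = 0) (hb : (b : ZMod 2) = 1) (p : V) :
    ((wdegZ G (abWeight a b c) p : ℤ) : ZMod 2) = bdry c p := by
  rw [wdegZ_abWeight hc, bdry_eq_oddCount]
  push_cast
  rw [ha, hb]
  ring

/-- If one side of a linked set is even, the parity of the weighted degree can distinguish the two
sides. -/
lemma Linked.exists_weighting_of_even {S A : Finset V} (hS : Linked G S)
    (hA : ∀ p q, G.Adj p q → (p ∈ A ↔ q ∉ A)) (hclosed : ∀ p ∈ S, ∀ q, G.Adj p q → q ∈ S)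
    (heven : (S.filter (· ∈ A)).card % 2 = 0) {a b : ℤ}
    (ha : (a : ZMod 2) = 0) (hb : (b : ZMod 2) = 1) :
    ∃ c : Sym2 V → ZMod 2, ∀ p ∈ S, ∀ q, G.Adj p q →
      wdegZ G (abWeight a b c) p ≠ wdegZ G (abWeight a b c) q := by
  obtain ⟨c, hc, hc'⟩ := hS.exists_join (fun p => if p ∈ A then 1 else 0) (by
    rw [Finset.sum_boole]
    exact (ZMod.natCast_eq_zero_iff _ _).2 (Nat.dvd_of_mod_eq_zero heven))
  refine ⟨c, fun p hp q hpq heq => ?_⟩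
  have h := congrArg (Int.cast : ℤ → ZMod 2) heq
  rw [wdegZ_abWeight_cast hc ha hb, wdegZ_abWeight_cast hc ha hb, hc', hc', if_pos hp,
    if_pos (hclosed p hp q hpq)] at h
  have := hA p q hpq
  by_cases hpA : p ∈ A <;> by_cases hqA : q ∈ A <;> simp_all

/-- A closed vertex set is split into a linked part `K`, a set `X` of twins, and their common
neighbourhood `U`, each vertex of which has a neighbour in `K`. -/
structure TwinPartition (G : SimpleGraph V) (K U X : Finset V) : Prop where
  linked : Linked G K
  notMem_of_mem_X : ∀ x ∈ X, x ∉ K ∧ x ∉ U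
  notMem_of_mem_U : ∀ u ∈ U, u ∉ K
  adj_iff : ∀ x ∈ X, ∀ p, G.Adj x p ↔ p ∈ U
  exists_adj : ∀ u ∈ U, ∃ y ∈ K, G.Adj u y
  closed : ∀ p ∈ K ∪ U ∪ X, ∀ q, G.Adj p q → q ∈ K ∪ U ∪ X

lemma exists_twinPartition {S A : Finset V} (hS : Linked G S) (hne : S.Nonempty)
    (hA : ∀ p q, G.Adj p q → (p ∈ A ↔ q ∉ A)) (hclosed : ∀ p ∈ S, ∀ q, G.Adj p q → q ∈ S)
    (hmin : ∀ v : V, 3 ≤ G.degree v) :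
    ∃ K U X : Finset V, K ∪ U ∪ X = S ∧ X.Nonempty ∧ TwinPartition G K U X := by
  let Q : Finset V → V → Prop := fun K v =>
    Linked G K ∧ K ⊆ S ∧ K.Nonempty ∧ v ∈ S ∧ v ∉ K ∧ ∀ y ∈ K, ¬ G.Adj v y
  have hdeg : ∀ v x : V, ∃ y, G.Adj v y ∧ y ≠ x := fun v x => by
    have h1 : 1 < (G.neighborFinset v).card := by
      rw [SimpleGraph.card_neighborFinset_eq_degree]
      have := hmin v
      omega
    obtain ⟨y, hy, hyx⟩ := Finset.exists_mem_ne h1 x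
    exact ⟨y, by simpa using hy, hyx⟩
  obtain ⟨K, ⟨v, hv⟩, hmax⟩ : ∃ K : Finset V, (∃ v, Q K v) ∧
      ∀ L : Finset V, (∃ v, Q L v) → L.card ≤ K.card := by
    have hex : ∃ K : Finset V, ∃ v, Q K v := by
      obtain ⟨v, hv⟩ := hne
      obtain ⟨u, hu, -⟩ := hdeg v v
      obtain ⟨w, hw, hwv⟩ := hdeg u v
      refine ⟨{w}, v, linked_singleton w, ?_, Finset.singleton_nonempty w, hv, ?_, ?_⟩
      · simpa using hclosed u (hclosed v hv u hu) w hw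
      · simpa using hwv.symm
      · intro y hy hvy
        rw [Finset.mem_singleton] at hy
        subst hy
        have h1 := hA _ _ hu
        have h2 := hA _ _ hw
        have h3 := hA _ _ hvy
        tauto
    obtain ⟨K, hK, hK'⟩ := (Finset.univ.filter (fun K : Finset V => ∃ v, Q K v)).exists_max_image
      Finset.card (by obtain ⟨K, hK⟩ := hex; exact ⟨K, by simpa using hK⟩)
    exact ⟨K, by simpa using hK, fun L hL => hK' L (by simpa using hL)⟩
  set U : Finset V := Finset.univ.filter (fun u => u ∉ K ∧ ∃ y ∈ K, G.Adj u y) with hU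
  have hmemU : ∀ u, u ∈ U ↔ u ∉ K ∧ ∃ y ∈ K, G.Adj u y := fun u => by simp [hU]
  have hQ : ∀ x, Q K x → ∀ u ∈ U, G.Adj x u := by
    rintro x ⟨hK, hKS, hKne, hxS, hxK, hxadj⟩ u hu
    obtain ⟨huK, y, hy, huy⟩ := (hmemU u).1 hu
    by_contra hxu
    have := hmax (insert u K) ⟨x, hK.insert hy huy.symm,
      Finset.insert_subset (hclosed y (hKS hy) u huy.symm) hKS,
      Finset.insert_nonempty _ _, hxS, ?_, ?_⟩
    · rw [Finset.card_insert_of_notMem huK] at this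
      omega
    · rw [Finset.mem_insert]
      rintro (rfl | h)
      · exact hxadj y hy huy
      · exact hxK h
    · intro z hz
      rcases Finset.mem_insert.1 hz with rfl | hz
      · exact hxu
      · exact hxadj z hz
  obtain ⟨hK, hKS, hKne, hvS, hvK, hvadj⟩ := id hv
  have hXQ : ∀ x ∈ S, x ∉ K → x ∉ U → Q K x := fun x hxS hxK hxU =>
    ⟨hK, hKS, hKne, hxS, hxK, fun y hy h => hxU ((hmemU x).2 ⟨hxK, y, hy, h⟩)⟩
  have hUS : U ⊆ S := fun u hu => by
    obtain ⟨-, y, hy, huy⟩ := (hmemU u).1 hu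
    exact hclosed y (hKS hy) u huy.symm
  obtain ⟨u, hu⟩ : U.Nonempty := by
    obtain ⟨k, hk⟩ := hKne
    obtain ⟨p, hp, q, hq, -, hpq⟩ := hS.exists_adj_of_ssubset hk (hKS hk) hvK hvS
    exact ⟨q, (hmemU q).2 ⟨hq, p, hp, hpq.symm⟩⟩
  have hmemX : ∀ x, x ∈ S \ (K ∪ U) ↔ x ∈ S ∧ x ∉ K ∧ x ∉ U := fun x => by simp
  have hunion : K ∪ U ∪ S \ (K ∪ U) = S :=
    Finset.union_sdiff_of_subset (Finset.union_subset hKS hUS)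
  refine ⟨K, U, S \ (K ∪ U), hunion, ⟨v, (hmemX v).2 ⟨hvS, hvK, fun h => ?_⟩⟩, hK,
    fun x hx => ((hmemX x).1 hx).2, fun u hu => ((hmemU u).1 hu).1, fun x hx p => ⟨fun hxp => ?_,
      ?_⟩, fun u hu => ((hmemU u).1 hu).2, ?_⟩
  · obtain ⟨-, y, hy, huy⟩ := (hmemU v).1 h
    exact hvadj y hy huy
  · obtain ⟨hxS, hxK, hxU⟩ := (hmemX x).1 hx
    by_contra hpU
    have hpK : p ∉ K := fun hpK => hxU ((hmemU x).2 ⟨hxK, p, hpK, hxp⟩)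
    have h1 := hA _ _ hxp
    have h2 := hA _ _ (hQ x (hXQ x hxS hxK hxU) u hu)
    have h3 := hA _ _ (hQ p (hXQ p (hclosed x hxS p hxp) hpK hpU) u hu)
    tauto
  · obtain ⟨hxS, hxK, hxU⟩ := (hmemX x).1 hx
    exact fun hp => hQ x (hXQ x hxS hxK hxU) p hp
  · rwa [hunion]

/-- The odd edges between `u ∈ U` and `D u` can be completed to a weighting in which only `v`
violates the parity condition. -/
lemma TwinPartition.exists_weighting_of_columns {K U X A : Finset V} (h : TwinPartition G K U X)
    (hA : ∀ p q, G.Adj p q → (p ∈ A ↔ q ∉ A)) (hUne : U.Nonempty) {v : V} (hv : v ∈ X)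
    (hvA : v ∈ A) (hodd : ((K ∪ U ∪ X).filter (· ∈ A)).card % 2 = 1)
    (hcard : (K ∪ U ∪ X).card % 2 = 0) (D : V → Finset V) (hD : ∀ u ∈ U, ∀ p ∈ D u, G.Adj u p)
    (e : ℕ) (hDe : ∀ u ∈ U, (D u).card % 2 = e % 2)
    (hrow : ∀ x ∈ X, x ≠ v → (U.filter (fun u => x ∈ D u)).card % 2 = (e + 1) % 2)
    (hrowv : (U.filter (fun u => v ∈ D u)).card % 2 = e % 2) {a b : ℤ}
    (ha : (a : ZMod 2) = 0) (hb : (b : ZMod 2) = 1)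
    (hne : ∀ u ∈ U, (b - a) * (((D u).card : ℤ) - ((U.filter (fun u => v ∈ D u)).card : ℤ)) ≠
      a * ((U.card : ℤ) - G.degree u)) :
    ∃ c : Sym2 V → ZMod 2, ∀ p ∈ K ∪ U ∪ X, ∀ q, G.Adj p q →
      wdegZ G (abWeight a b c) p ≠ wdegZ G (abWeight a b c) q := by
  set S := K ∪ U ∪ X with hS
  have hmemS : ∀ p, p ∈ S ↔ p ∈ K ∨ p ∈ U ∨ p ∈ X := fun p => by simp [hS]
  have hUA : ∀ u ∈ U, u ∉ A := fun u hu => (hA v u ((h.adj_iff v hv u).2 hu)).1 hvA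
  have hXA : ∀ x ∈ X, x ∈ A := fun x hx => by
    obtain ⟨u, hu⟩ := hUne
    exact (hA x u ((h.adj_iff x hx u).2 hu)).2 (hUA u hu)
  have hUU : ∀ u ∈ U, ∀ w ∈ U, ¬ G.Adj u w := fun u hu w hw huw =>
    hUA u hu ((hA u w huw).2 (hUA w hw))
  let c₀ : Sym2 V → ZMod 2 := fun e => if ∃ u ∈ U, ∃ q ∈ D u, e = s(u, q) then 1 else 0
  have hc₀ : ∀ p q, c₀ s(p, q) ≠ 0 ↔ (p ∈ U ∧ q ∈ D p) ∨ (q ∈ U ∧ p ∈ D q) := fun p q => by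
    have : c₀ s(p, q) ≠ 0 ↔ ∃ u ∈ U, ∃ r ∈ D u, s(p, q) = s(u, r) := by
      simp only [c₀, ne_eq, ite_eq_right_iff, one_ne_zero, imp_false, not_not]
    rw [this]
    constructor
    · rintro ⟨u, hu, r, hr, heq⟩
      rcases Sym2.eq_iff.1 heq with ⟨rfl, rfl⟩ | ⟨rfl, rfl⟩
      · exact Or.inl ⟨hu, hr⟩
      · exact Or.inr ⟨hu, hr⟩
    · rintro (⟨hp, hq⟩ | ⟨hq, hp⟩)
      · exact ⟨p, hp, q, hq, rfl⟩
      · exact ⟨q, hq, p, hp, Sym2.eq_swap⟩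
  have hsupp : SuppIn G S c₀ := by
    have key : ∀ u ∈ U, ∀ r ∈ D u, G.Adj u r ∧ u ∈ S ∧ r ∈ S := fun u hu r hr => by
      have huS : u ∈ S := (hmemS u).2 (Or.inr (Or.inl hu))
      exact ⟨hD u hu r hr, huS, h.closed u huS r (hD u hu r hr)⟩
    intro p q hpq
    rcases (hc₀ p q).1 hpq with ⟨hp, hq⟩ | ⟨hq, hp⟩
    · exact key p hp q hq
    · obtain ⟨h1, h2, h3⟩ := key q hq p hp
      exact ⟨h1.symm, h3, h2⟩
  have hcountU : ∀ u ∈ U, oddCount c₀ u = (D u).card := fun u hu => by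
    unfold oddCount
    congr 1
    ext q
    simp only [Finset.mem_filter, Finset.mem_univ, true_and]
    rw [hc₀]
    exact ⟨fun h => h.elim And.right fun h' => absurd (hD q h'.1 u h'.2) (hUU q h'.1 u hu),
      fun h => Or.inl ⟨hu, h⟩⟩
  have hcountX : ∀ x ∈ X, oddCount c₀ x = (U.filter (fun u => x ∈ D u)).card := fun x hx => by
    unfold oddCount
    congr 1
    ext q
    simp only [Finset.mem_filter, Finset.mem_univ, true_and]
    rw [hc₀]
    exact ⟨fun h' => h'.resolve_left fun h'' => (h.notMem_of_mem_X x hx).2 h''.1, Or.inr⟩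
  let τ : V → ZMod 2 := fun p => e + ((if p ∈ A then 1 else 0) + (if p = v then 1 else 0))
  have hvS : v ∈ S := (hmemS v).2 (Or.inr (Or.inr hv))
  have hτ : ∑ p ∈ S, τ p = 0 := by
    have h1 : ((S.card : ℕ) : ZMod 2) = 0 :=
      (ZMod.natCast_eq_zero_iff _ _).2 (Nat.dvd_of_mod_eq_zero hcard)
    have h2 : (((S.filter (· ∈ A)).card : ℕ) : ZMod 2) = (1 : ℕ) :=
      (ZMod.natCast_eq_natCast_iff' _ _ 2).2 hodd
    have h3 : ∑ p ∈ S, (if p = v then (1 : ZMod 2) else 0) = 1 := by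
      rw [Finset.sum_eq_single v (fun p _ hp => if_neg hp) (fun hv' => absurd hvS hv'), if_pos rfl]
    simp only [τ, Finset.sum_add_distrib, h3]
    simp only [Finset.sum_boole, Finset.sum_const, nsmul_eq_mul, h1, h2]
    simpa using add_self_zmod_two 1
  have hτ' : ∀ p ∈ S, p ∉ K → bdry c₀ p = τ p := fun p hp hpK => by
    rw [bdry_eq_oddCount]
    rcases ((hmemS p).1 hp).resolve_left hpK with hpU | hpX
    · have hpv : p ≠ v := fun hpv => (h.notMem_of_mem_X v hv).2 (hpv ▸ hpU)
      simp only [τ, hcountU p hpU, if_neg (hUA p hpU), if_neg hpv, add_zero]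
      exact (ZMod.natCast_eq_natCast_iff' _ _ 2).2 (hDe p hpU)
    · simp only [τ, hcountX p hpX, if_pos (hXA p hpX)]
      by_cases hpv : p = v
      · rw [if_pos hpv, add_self_zmod_two, add_zero, hpv]
        exact (ZMod.natCast_eq_natCast_iff' _ _ 2).2 hrowv
      · rw [if_neg hpv, add_zero]
        exact_mod_cast (ZMod.natCast_eq_natCast_iff' _ _ 2).2 (hrow p hpX hpv)
  obtain ⟨c, hc, hcK, hcτ⟩ := h.linked.exists_completion
    (fun p hp => (hmemS p).2 (Or.inl hp)) hsupp hτ hτ'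
  have hcount : ∀ p ∉ K, oddCount c p = oddCount c₀ p := fun p hp => by
    unfold oddCount
    simp only [hcK p hp]
  have hneU : ∀ u ∈ U, wdegZ G (abWeight a b c) u ≠ wdegZ G (abWeight a b c) v := fun u hu heq => by
    have hdeg : G.degree v = U.card := by
      rw [← SimpleGraph.card_neighborFinset_eq_degree]
      congr 1
      ext p
      simpa using h.adj_iff v hv p
    rw [wdegZ_abWeight hc, wdegZ_abWeight hc, hcount u (h.notMem_of_mem_U u hu),
      hcount v (h.notMem_of_mem_X v hv).1, hcountU u hu, hcountX v hv, hdeg] at heq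
    exact hne u hu (by linear_combination heq)
  refine ⟨c, fun p hp q hpq => ?_⟩
  by_cases hpv : p = v
  · subst hpv
    exact (hneU q ((h.adj_iff p hv q).1 hpq)).symm
  by_cases hqv : q = v
  · subst hqv
    exact hneU p ((h.adj_iff q hv p).1 hpq.symm)
  intro heq
  have h1 := congrArg (Int.cast : ℤ → ZMod 2) heq
  rw [wdegZ_abWeight_cast hc ha hb, wdegZ_abWeight_cast hc ha hb, hcτ p hp,
    hcτ q (h.closed p hp q hpq)] at h1
  have := hA p q hpq
  by_cases hpA : p ∈ A <;> by_cases hqA : q ∈ A <;> simp_all [τ]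

lemma TwinPartition.exists_weighting {K U X A : Finset V} (h : TwinPartition G K U X)
    (hA : ∀ p q, G.Adj p q → (p ∈ A ↔ q ∉ A)) (hXA : ∃ v ∈ X, v ∈ A)
    (hmin : ∀ v : V, 3 ≤ G.degree v) (hodd : ((K ∪ U ∪ X).filter (· ∈ A)).card % 2 = 1)
    (hcard : (K ∪ U ∪ X).card % 2 = 0) {a b : ℤ}
    (ha : (a : ZMod 2) = 0) (hb : (b : ZMod 2) = 1) :
    ∃ c : Sym2 V → ZMod 2, ∀ p ∈ K ∪ U ∪ X, ∀ q, G.Adj p q →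
      wdegZ G (abWeight a b c) p ≠ wdegZ G (abWeight a b c) q := by
  obtain ⟨v, hv, hvA⟩ := hXA
  have hab : b - a ≠ 0 := fun h0 => by
    have := congrArg (Int.cast : ℤ → ZMod 2) h0
    push_cast at this
    rw [ha, hb] at this
    exact absurd this (by decide)
  have hU3 : 3 ≤ U.card := by
    have : U = G.neighborFinset v := by
      ext p
      simpa using (h.adj_iff v hv p).symm
    rw [this, SimpleGraph.card_neighborFinset_eq_degree]
    exact hmin v
  have hUne : U.Nonempty := Finset.card_pos.1 (by omega)
  by_cases hX2 : 2 ≤ X.card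
  · obtain ⟨e, col, hcol⟩ := exists_isColumnChoice hv hX2 hU3
      (fun u => a * ((U.card : ℤ) - G.degree u)) hab
    choose! y hyK hy using h.exists_adj
    let D : V → Finset V := fun u => if (col u).card % 2 = e % 2 then col u else insert (y u) (col u)
    have hmemD : ∀ x ∈ X, ∀ u ∈ U, x ∈ D u ↔ x ∈ col u := fun x hx u hu => by
      have : x ≠ y u := fun hxy => (h.notMem_of_mem_X x hx).1 (hxy ▸ hyK u hu)
      simp only [D]
      split_ifs <;> simp [this]
    have hcardD : ∀ u ∈ U, ((D u).card = (col u).card ∨ (D u).card = (col u).card + 1) ∧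
        (D u).card % 2 = e % 2 := fun u hu => by
      have : y u ∉ col u := fun hyc =>
        (h.notMem_of_mem_X _ (hcol.subset u hyc)).1 (hyK u hu)
      simp only [D]
      split_ifs with hpar
      · exact ⟨Or.inl rfl, hpar⟩
      · rw [Finset.card_insert_of_notMem this]
        exact ⟨Or.inr rfl, by omega⟩
    have hrowD : ∀ x ∈ X, U.filter (fun u => x ∈ D u) = U.filter (fun u => x ∈ col u) :=
      fun x hx => Finset.filter_congr fun u hu => hmemD x hx u hu
    refine h.exists_weighting_of_columns hA hUne hv hvA hodd hcard D (fun u hu p hp => ?_) e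
      (fun u hu => (hcardD u hu).2) (fun x hx hxv => ?_) ?_ ha hb (fun u hu => ?_)
    · have hcolAdj : ∀ p ∈ col u, G.Adj u p := fun p hp =>
        ((h.adj_iff p (hcol.subset u hp) u).2 hu).symm
      simp only [D] at hp
      split_ifs at hp
      · exact hcolAdj p hp
      · rcases Finset.mem_insert.1 hp with rfl | hp
        · exact hy u hu
        · exact hcolAdj p hp
    · rw [hrowD x hx]
      exact hcol.row x hx hxv
    · rw [hrowD v hv]
      exact hcol.row_self
    · rw [hrowD v hv]
      exact hcol.ne u hu _ (hcardD u hu).1 (hcardD u hu).2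
  · have hXv : ∀ x ∈ X, x = v := fun x hx =>
      Finset.card_le_one.1 (by omega) x hx v hv
    have hUA : ∀ u ∈ U, u ∉ A := fun u hu => (hA v u ((h.adj_iff v hv u).2 hu)).1 hvA
    have hpair : ∀ u ∈ U, ∃ T : Finset V, T.card = 2 ∧ T ⊆ K ∧ ∀ p ∈ T, G.Adj u p := fun u hu => by
      have h1 : 2 ≤ ((G.neighborFinset u).erase v).card := by
        have h2 := Finset.pred_card_le_card_erase (s := G.neighborFinset u) (a := v)
        rw [SimpleGraph.card_neighborFinset_eq_degree] at h2
        have := hmin u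
        omega
      obtain ⟨T, hT, hT2⟩ := Finset.exists_subset_card_eq h1
      have hTadj : ∀ p ∈ T, G.Adj u p := fun p hp => by
        simpa using Finset.mem_of_mem_erase (hT hp)
      refine ⟨T, hT2, fun p hp => ?_, hTadj⟩
      have hpS := h.closed u (by simp [hu]) p (hTadj p hp)
      simp only [Finset.mem_union] at hpS
      rcases hpS with (hpK | hpU) | hpX
      · exact hpK
      · exact absurd ((hA u p (hTadj p hp)).2 (hUA p hpU)) (hUA u hu)
      · exact absurd (hXv p hpX) (Finset.ne_of_mem_erase (hT hp))
    choose! T hT2 hTK hTadj using hpair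
    let D : V → Finset V := fun u => if a * ((U.card : ℤ) - G.degree u) = 0 then T u else ∅
    have hrow : U.filter (fun u => v ∈ D u) = ∅ := by
      refine Finset.filter_false_of_mem fun u hu hvu => ?_
      simp only [D] at hvu
      split_ifs at hvu
      · exact (h.notMem_of_mem_X v hv).1 (hTK u hu hvu)
      · simp at hvu
    refine h.exists_weighting_of_columns hA hUne hv hvA hodd hcard D (fun u hu p hp => ?_) 0
      (fun u hu => ?_) (fun x hx hxv => absurd (hXv x hx) hxv) (by simp [hrow]) ha hb
      (fun u hu => ?_)
    · simp only [D] at hp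
      split_ifs at hp
      · exact hTadj u hu p hp
      · simp at hp
    · simp only [D]
      split_ifs
      · rw [hT2 u hu]
      · rfl
    · rw [hrow]
      simp only [D]
      split_ifs with h0
      · rw [h0, hT2 u hu]
        simpa using hab
      · simpa using Ne.symm h0

lemma Linked.exists_weighting {S A : Finset V} (hS : Linked G S)
    (hA : ∀ p q, G.Adj p q → (p ∈ A ↔ q ∉ A)) (hclosed : ∀ p ∈ S, ∀ q, G.Adj p q → q ∈ S)
    (hmin : ∀ v : V, 3 ≤ G.degree v) {a b : ℤ}
    (ha : (a : ZMod 2) = 0) (hb : (b : ZMod 2) = 1) :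
    ∃ c : Sym2 V → ZMod 2, ∀ p ∈ S, ∀ q, G.Adj p q →
      wdegZ G (abWeight a b c) p ≠ wdegZ G (abWeight a b c) q := by
  have hA' : ∀ p q, G.Adj p q → (p ∈ Aᶜ ↔ q ∉ Aᶜ) := fun p q hpq => by
    have := hA p q hpq
    simp only [Finset.mem_compl]
    tauto
  by_cases h1 : (S.filter (· ∈ A)).card % 2 = 0
  · exact hS.exists_weighting_of_even hA hclosed h1 ha hb
  by_cases h2 : (S.filter (· ∈ Aᶜ)).card % 2 = 0
  · exact hS.exists_weighting_of_even hA' hclosed h2 ha hb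
  have hsum : (S.filter (· ∈ A)).card + (S.filter (· ∈ Aᶜ)).card = S.card := by
    simp only [Finset.mem_compl]
    exact Finset.card_filter_add_card_filter_not _
  have hne : S.Nonempty := Finset.card_pos.1 (by omega)
  obtain ⟨K, U, X, rfl, ⟨v, hv⟩, h⟩ := exists_twinPartition hS hne hA hclosed hmin
  by_cases hvA : v ∈ A
  · exact h.exists_weighting hA ⟨v, hv, hvA⟩ hmin (by omega) (by omega) ha hb
  · exact h.exists_weighting hA' ⟨v, hv, by simpa using hvA⟩ hmin (by omega) (by omega)
      ha hb

lemma HasABProperty.symm {a b : ℤ} (h : HasABProperty G a b) : HasABProperty G b a := by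
  obtain ⟨w, hw, hw'⟩ := h
  exact ⟨w, fun e he => (hw e he).symm, hw'⟩

lemma hasABProperty_of_even_odd (hbip : G.Colorable 2) (hmin : ∀ v : V, 3 ≤ G.degree v) {a b : ℤ}
    (ha : (a : ZMod 2) = 0) (hb : (b : ZMod 2) = 1) : HasABProperty G a b := by
  obtain ⟨col⟩ := hbip
  have hA : ∀ p q, G.Adj p q → (p ∈ Finset.univ.filter (fun p => col p = 0) ↔
      q ∉ Finset.univ.filter (fun p => col p = 0)) := fun p q hpq => by
    have := col.valid hpq
    simp only [Finset.mem_filter, Finset.mem_univ, true_and]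
    omega
  have hcomp : ∀ C : G.ConnectedComponent, ∃ c : Sym2 V → ZMod 2, ∀ p,
      G.connectedComponentMk p = C → ∀ q, G.Adj p q →
        wdegZ G (abWeight a b c) p ≠ wdegZ G (abWeight a b c) q := fun C => by
    induction C using SimpleGraph.ConnectedComponent.ind with | _ r => ?_
    obtain ⟨c, hc⟩ := (linked_reachable (G := G) r).exists_weighting hA
      (fun p hp q hpq => by
        simp only [Finset.mem_filter, Finset.mem_univ, true_and] at hp ⊢
        exact hp.trans hpq.reachable) hmin ha hb
    refine ⟨c, fun p hp => hc p ?_⟩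
    simpa using (SimpleGraph.ConnectedComponent.eq.1 hp).symm
  choose c hc using hcomp
  refine ⟨fun e => abWeight a b (c (G.connectedComponentMk e.out.1)) e, fun e _ => ?_,
    fun p q hpq heq => ?_⟩
  · simp only [abWeight]
    split_ifs
    · exact Or.inl rfl
    · exact Or.inr rfl
  · have key : ∀ z, wdegZ G (fun e => abWeight a b (c (G.connectedComponentMk e.out.1)) e) z =
        wdegZ G (abWeight a b (c (G.connectedComponentMk z))) z := fun z => by
      refine Finset.sum_congr rfl fun w hw => ?_
      have hzw : G.Adj z w := by simpa using hw
      have : G.connectedComponentMk (s(z, w)).out.1 = G.connectedComponentMk z := by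
        rcases Sym2.mem_iff.1 (Sym2.out_fst_mem s(z, w)) with h | h <;> rw [h]
        exact SimpleGraph.ConnectedComponent.eq.2 hzw.symm.reachable
      simp only [this]
    rw [key, key, ← SimpleGraph.ConnectedComponent.eq.2 hpq.reachable] at heq
    exact hc _ p rfl q hpq heq

end Weightings

/-- Every finite simple bipartite graph of minimum degree at least `3`
has the `{a,b}`-property for all non-negative integers `a, b` of distinct parity. -/
theorem statement9 {V : Type} [Fintype V] (G : SimpleGraph V) (hbip : G.Colorable 2)
    (hmin : ∀ v : V, 3 ≤ G.degree v)
    (a b : ℤ) (ha : 0 ≤ a) (hb : 0 ≤ b) (hab : a % 2 ≠ b % 2) :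
    HasABProperty G a b := by
  rcases Int.emod_two_eq_zero_or_one a with h | h <;>
    rcases Int.emod_two_eq_zero_or_one b with h' | h'
  · exact absurd (h.trans h'.symm) hab
  · exact hasABProperty_of_even_odd hbip hmin ((ZMod.intCast_zmod_eq_zero_iff_dvd _ 2).2 (by omega))
      (by exact_mod_cast (ZMod.intCast_eq_intCast_iff' b 1 2).2 h')
  · exact (hasABProperty_of_even_odd hbip hmin
      ((ZMod.intCast_zmod_eq_zero_iff_dvd _ 2).2 (by omega))
      (by exact_mod_cast (ZMod.intCast_eq_intCast_iff' a 1 2).2 h)).symm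
  · exact absurd (h.trans h'.symm) hab
end

section
/- Let G be a finite connected bipartite graph with an even number of vertices in each bipartition class and let v be a vertex of G. Let G' be the graph obtained from G by adding two new vertices v1 and v2 and the edges vv1 and v1v2. Then G is a G_v(−)-graph if and only if G' is bad. -/
open scoped Classical

/-- The colour of `x`: its weighted degree, increased by `1` if `x = v`
(i.e. the weighted degree of `v` is increased by `1`). -/
noncomputable def wdegPlus {V : Type} [Fintype V] (G : SimpleGraph V) (w : Sym2 V → ℕ)
    (v x : V) : ℕ :=
  wdeg G w x + if x = v then 1 else 0

/-- `G` is a `G_v(−)`-graph: there is no `{0,1}`-weighting of `G` which is proper when the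
weighted degree of `v` is increased by `1`. -/
def GvMinus {V : Type} [Fintype V] (G : SimpleGraph V) (v : V) : Prop :=
  ¬ ∃ w : Sym2 V → ℕ, Is01Weighting G w ∧
      ∀ ⦃x y : V⦄, G.Adj x y → wdegPlus G w v x ≠ wdegPlus G w v y

/-- `G` is a `G_v(a,b)`-graph: in every proper `{0,1}`-weighting of `G` the vertex `v` has
weighted degree `a`, and in every `{0,1}`-weighting of `G` which is proper when the weighted
degree of `v` is increased by `1`, the increased weighted degree of `v` is `b`. -/
def GvAB {V : Type} [Fintype V] (G : SimpleGraph V) (v : V) (a b : ℕ) : Prop :=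
  (∀ w : Sym2 V → ℕ, Is01Weighting G w →
      (∀ ⦃x y : V⦄, G.Adj x y → wdeg G w x ≠ wdeg G w y) → wdeg G w v = a) ∧
  (∀ w : Sym2 V → ℕ, Is01Weighting G w →
      (∀ ⦃x y : V⦄, G.Adj x y → wdegPlus G w v x ≠ wdegPlus G w v y) →
        wdeg G w v + 1 = b)

/-- The graph `G'` obtained from `G` by adding two new vertices `v₁ = inr 0`, `v₂ = inr 1`
and the edges `v v₁` and `v₁ v₂`. -/
def addPendantPath2 {V : Type} (G : SimpleGraph V) (v : V) : SimpleGraph (V ⊕ Fin 2) :=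
  SimpleGraph.fromEdgeSet ((Sym2.map Sum.inl '' G.edgeSet) ∪
    {s(Sum.inl v, Sum.inr 0), s(Sum.inr 0, Sum.inr 1)})

theorem addPendantPath2_adj_inl_inl {V : Type} (G : SimpleGraph V) (v x y : V) :
    (addPendantPath2 G v).Adj (Sum.inl x) (Sum.inl y) ↔ G.Adj x y := by
  have h : s(Sum.inl x, Sum.inl y) ∈ Sym2.map (Sum.inl : V → V ⊕ Fin 2) '' G.edgeSet ↔
      G.Adj x y := by
    rw [← Sym2.map_mk, (Sym2.map.injective Sum.inl_injective).mem_set_image,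
      SimpleGraph.mem_edgeSet]
  rw [addPendantPath2, SimpleGraph.fromEdgeSet_adj, Set.mem_union, h]
  simpa using fun hxy : G.Adj x y => hxy.ne

theorem addPendantPath2_adj_inl_inr {V : Type} (G : SimpleGraph V) (v x : V) (i : Fin 2) :
    (addPendantPath2 G v).Adj (Sum.inl x) (Sum.inr i) ↔ x = v ∧ i = 0 := by
  have h : s(Sum.inl x, Sum.inr i) ∉ Sym2.map (Sum.inl : V → V ⊕ Fin 2) '' G.edgeSet := by
    rintro ⟨e, -, he⟩
    induction e with | _ a b => simp at he
  rw [addPendantPath2, SimpleGraph.fromEdgeSet_adj, Set.mem_union]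
  simp only [h, false_or]
  simp

theorem addPendantPath2_adj_inr_inl {V : Type} (G : SimpleGraph V) (v x : V) (i : Fin 2) :
    (addPendantPath2 G v).Adj (Sum.inr i) (Sum.inl x) ↔ x = v ∧ i = 0 := by
  rw [SimpleGraph.adj_comm, addPendantPath2_adj_inl_inr]

theorem addPendantPath2_adj_inr_inr {V : Type} (G : SimpleGraph V) (v : V) (i j : Fin 2) :
    (addPendantPath2 G v).Adj (Sum.inr i) (Sum.inr j) ↔ i ≠ j := by
  have h : s(Sum.inr i, Sum.inr j) ∉ Sym2.map (Sum.inl : V → V ⊕ Fin 2) '' G.edgeSet := by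
    rintro ⟨e, -, he⟩
    induction e with | _ a b => simp at he
  rw [addPendantPath2, SimpleGraph.fromEdgeSet_adj, Set.mem_union]
  simp only [h, false_or]
  fin_cases i <;> fin_cases j <;> simp

theorem wdeg_addPendantPath2_inl {V : Type} [Fintype V] (G : SimpleGraph V) (v : V)
    (w : Sym2 (V ⊕ Fin 2) → ℕ) (x : V) :
    wdeg (addPendantPath2 G v) w (Sum.inl x) =
      wdeg G (fun e => w (e.map Sum.inl)) x +
        if x = v then w s(Sum.inl v, Sum.inr 0) else 0 := by
  simp only [wdeg, Finset.sum_filter, Fintype.sum_sum_type, addPendantPath2_adj_inl_inl,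
    addPendantPath2_adj_inl_inr, Fin.sum_univ_two, Sym2.map_mk]
  by_cases hx : x = v <;> simp [hx]

theorem wdeg_addPendantPath2_inr_zero {V : Type} [Fintype V] (G : SimpleGraph V) (v : V)
    (w : Sym2 (V ⊕ Fin 2) → ℕ) :
    wdeg (addPendantPath2 G v) w (Sum.inr 0) =
      w s(Sum.inl v, Sum.inr 0) + w s(Sum.inr 0, Sum.inr 1) := by
  simp only [wdeg, Finset.sum_filter, Fintype.sum_sum_type, addPendantPath2_adj_inr_inl,
    addPendantPath2_adj_inr_inr, Fin.sum_univ_two]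
  simp [Sym2.eq_swap]

theorem wdeg_addPendantPath2_inr_one {V : Type} [Fintype V] (G : SimpleGraph V) (v : V)
    (w : Sym2 (V ⊕ Fin 2) → ℕ) :
    wdeg (addPendantPath2 G v) w (Sum.inr 1) = w s(Sum.inr 0, Sum.inr 1) := by
  simp only [wdeg, Finset.sum_filter, Fintype.sum_sum_type, addPendantPath2_adj_inr_inl,
    addPendantPath2_adj_inr_inr, Fin.sum_univ_two]
  simp [Sym2.eq_swap]

/-- The extension of an edge-weighting of `G` to `addPendantPath2 G v` which gives weight `1` to
`v v₁` and weight `b` to `v₁ v₂`. -/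
noncomputable def extendWeighting {V : Type} (w : Sym2 V → ℕ) (v : V) (b : ℕ)
    (e : Sym2 (V ⊕ Fin 2)) : ℕ :=
  if e = s(Sum.inl v, Sum.inr 0) then 1
  else if e = s(Sum.inr 0, Sum.inr 1) then b
  else w (e.map (Sum.elim id fun _ => v))

theorem extendWeighting_map_inl {V : Type} (w : Sym2 V → ℕ) (v : V) (b : ℕ) (e : Sym2 V) :
    extendWeighting w v b (e.map Sum.inl) = w e := by
  induction e with | _ x y => simp [extendWeighting]

theorem extendWeighting_inl_inr {V : Type} (w : Sym2 V → ℕ) (v : V) (b : ℕ) :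
    extendWeighting w v b s(Sum.inl v, Sum.inr 0) = 1 := by
  simp [extendWeighting]

theorem extendWeighting_inr_inr {V : Type} (w : Sym2 V → ℕ) (v : V) (b : ℕ) :
    extendWeighting w v b s(Sum.inr 0, Sum.inr 1) = b := by
  simp [extendWeighting]

theorem is01Weighting_extendWeighting {V : Type} {G : SimpleGraph V} {w : Sym2 V → ℕ}
    (hw : Is01Weighting G w) (v : V) {b : ℕ} (hb : b = 0 ∨ b = 1) :
    Is01Weighting (addPendantPath2 G v) (extendWeighting w v b) := by
  intro e he
  rw [addPendantPath2, SimpleGraph.edgeSet_fromEdgeSet] at he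
  rcases he.1 with ⟨e, heG, rfl⟩ | rfl | rfl
  · rw [extendWeighting_map_inl]
    exact hw e heG
  · exact Or.inr (extendWeighting_inl_inr w v b)
  · rwa [extendWeighting_inr_inr]

theorem hasZeroOneProperty_addPendantPath2_iff {V : Type} [Fintype V] (G : SimpleGraph V)
    (v : V) :
    HasZeroOneProperty (addPendantPath2 G v) ↔
      ∃ w : Sym2 V → ℕ, Is01Weighting G w ∧
        ∀ ⦃x y : V⦄, G.Adj x y → wdegPlus G w v x ≠ wdegPlus G w v y := by
  constructor
  · rintro ⟨w, hw, hp⟩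
    have h1 : w s(Sum.inl v, Sum.inr 0) = 1 := by
      have hne := hp ((addPendantPath2_adj_inr_inr G v 0 1).2 (by decide))
      rw [wdeg_addPendantPath2_inr_zero, wdeg_addPendantPath2_inr_one] at hne
      have h01 := hw s(Sum.inl v, Sum.inr 0) ((addPendantPath2_adj_inl_inr G v v 0).2 ⟨rfl, rfl⟩)
      omega
    refine ⟨fun e => w (e.map Sum.inl), fun e he => hw _ ?_, fun x y hxy => ?_⟩
    · induction e with | _ x y => exact (addPendantPath2_adj_inl_inl G v x y).2 he
    · have hne := hp ((addPendantPath2_adj_inl_inl G v x y).2 hxy)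
      rwa [wdeg_addPendantPath2_inl, wdeg_addPendantPath2_inl, h1] at hne
  · rintro ⟨w, hw, hp⟩
    obtain ⟨b, hb, hbv⟩ : ∃ b : ℕ, (b = 0 ∨ b = 1) ∧ wdeg G w v ≠ b := by
      by_cases h : wdeg G w v = 0
      · exact ⟨1, Or.inr rfl, by omega⟩
      · exact ⟨0, Or.inl rfl, h⟩
    have hinl (x : V) : wdeg (addPendantPath2 G v) (extendWeighting w v b) (Sum.inl x) =
        wdegPlus G w v x := by
      simp only [wdeg_addPendantPath2_inl, extendWeighting_map_inl, extendWeighting_inl_inr,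
        wdegPlus]
    have hzero : wdeg (addPendantPath2 G v) (extendWeighting w v b) (Sum.inr 0) = 1 + b := by
      rw [wdeg_addPendantPath2_inr_zero, extendWeighting_inl_inr, extendWeighting_inr_inr]
    have hone : wdeg (addPendantPath2 G v) (extendWeighting w v b) (Sum.inr 1) = b := by
      rw [wdeg_addPendantPath2_inr_one, extendWeighting_inr_inr]
    have hv : wdegPlus G w v v ≠ 1 + b := by
      rw [wdegPlus, if_pos rfl]
      omega
    refine ⟨extendWeighting w v b, is01Weighting_extendWeighting hw v hb, ?_⟩
    rintro (x | i) (y | j) hxy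
    · rw [hinl, hinl]
      exact hp ((addPendantPath2_adj_inl_inl G v x y).1 hxy)
    · obtain ⟨rfl, rfl⟩ := (addPendantPath2_adj_inl_inr G v x j).1 hxy
      rwa [hinl, hzero]
    · obtain ⟨rfl, rfl⟩ := (addPendantPath2_adj_inr_inl G v y i).1 hxy
      rw [hinl, hzero]
      exact hv.symm
    · have hij := (addPendantPath2_adj_inr_inr G v i j).1 hxy
      fin_cases i <;> fin_cases j <;> simp_all

/-- Let `G` be a finite connected bipartite graph with both bipartition
classes of even size and let `v` be a vertex. Then `G` is a `G_v(−)`-graph if and only if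
the graph obtained by attaching a pendant path `v v₁ v₂` of length 2 at `v` is bad. -/
theorem statement10 {V : Type} [Fintype V] (G : SimpleGraph V) (hconn : G.Connected)
    (c : V → Bool) (hc : ∀ ⦃x y : V⦄, G.Adj x y → c x ≠ c y)
    (hX : Even (Finset.univ.filter fun x => c x = true).card)
    (hY : Even (Finset.univ.filter fun x => c x = false).card)
    (v : V) :
    GvMinus G v ↔ ¬ HasZeroOneProperty (addPendantPath2 G v) := by
  rw [GvMinus, hasZeroOneProperty_addPendantPath2_iff]
end

section
/- Let G be a finite simple connected bipartite graph without the {0,1}-property. If v is a vertex of degree 1 in G and v' is the unique neighbour of v, then every edge incident with v' is a bridge of G. -/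
open scoped Classical

theorem sum_single_edge {V : Type} [Fintype V] {a b : V} (hab : a ≠ b) (x : V) :
    ∑ u, (Pi.single s(a, b) 1 : Sym2 V → ZMod 2) s(x, u) =
      (Pi.single a 1 : V → ZMod 2) x + (Pi.single b 1 : V → ZMod 2) x := by
  have h (u : V) : (Pi.single s(a, b) 1 : Sym2 V → ZMod 2) s(x, u) =
      (if x = a then if u = b then 1 else 0 else 0) +
        (if x = b then if u = a then 1 else 0 else 0) := by
    simp only [Pi.single_apply, Sym2.eq_iff]
    grind
  simp only [h, Finset.sum_add_distrib, Pi.single_apply]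
  congr 1
  · split_ifs <;> simp
  · split_ifs <;> simp

/-- `f` is the vector of vertex degrees modulo two of some subgraph of `G`, the latter being given
by its indicator function `w`. -/
def IsDegreeParity {V : Type} [Fintype V] (G : SimpleGraph V) (f : V → ZMod 2) : Prop :=
  ∃ w : Sym2 V → ZMod 2, (∀ e ∉ G.edgeSet, w e = 0) ∧ ∀ x, ∑ u, w s(x, u) = f x

namespace IsDegreeParity

variable {V : Type} [Fintype V] {G : SimpleGraph V} {f g : V → ZMod 2}

theorem zero : IsDegreeParity G 0 :=
  ⟨0, fun _ _ => rfl, fun x => by simp⟩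

theorem add (hf : IsDegreeParity G f) (hg : IsDegreeParity G g) : IsDegreeParity G (f + g) := by
  obtain ⟨w, hw, hwf⟩ := hf
  obtain ⟨w', hw', hwg⟩ := hg
  refine ⟨w + w', fun e he => ?_, fun x => ?_⟩
  · simp [hw e he, hw' e he]
  · simp [Finset.sum_add_distrib, hwf, hwg]

theorem sum {ι : Type} (s : Finset ι) (F : ι → V → ZMod 2)
    (h : ∀ i ∈ s, IsDegreeParity G (F i)) : IsDegreeParity G (∑ i ∈ s, F i) :=
  Finset.sum_induction F (IsDegreeParity G) (fun _ _ => add) zero h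

theorem of_adj {a b : V} (h : G.Adj a b) : IsDegreeParity G (Pi.single a 1 + Pi.single b 1) := by
  refine ⟨Pi.single s(a, b) 1, fun e he => ?_, fun x => sum_single_edge h.ne x⟩
  rw [Pi.single_apply, if_neg]
  rintro rfl
  exact he h

theorem of_reachable {a b : V} (h : G.Reachable a b) :
    IsDegreeParity G (Pi.single a 1 + Pi.single b 1) := by
  have add_self (g : V → ZMod 2) : g + g = 0 := funext fun x => CharTwo.add_self_eq_zero (g x)
  obtain ⟨p⟩ := h
  induction p with
  | nil => exact (add_self _).symm ▸ zero
  | @cons a c b hadj p ih =>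
    have h := (of_adj hadj).add ih
    rwa [add_assoc, ← add_assoc (Pi.single c 1), add_self, zero_add] at h

/-- In a connected graph every even set of vertices is the set of odd-degree vertices of some
subgraph. -/
theorem of_connected (hG : G.Connected) (hf : ∑ x, f x = 0) : IsDegreeParity G f := by
  obtain ⟨r⟩ := hG.nonempty
  have key : IsDegreeParity G (∑ a, f a • (Pi.single a 1 + Pi.single r 1 : V → ZMod 2)) := by
    refine sum _ _ fun a _ => ?_
    obtain h | h : f a = 0 ∨ f a = 1 := by generalize f a = t; revert t; decide
    · simpa [h] using zero
    · simpa [h] using of_reachable (hG.preconnected a r)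
  convert key using 1
  simp only [smul_add, Finset.sum_add_distrib, ← Finset.sum_smul, hf, zero_smul, add_zero]
  ext x
  simp [Pi.single_apply]

end IsDegreeParity

theorem is01Weighting_val {V : Type} (G : SimpleGraph V) (w : Sym2 V → ZMod 2) :
    Is01Weighting G fun e => (w e).val := by
  intro e _
  have := ZMod.val_lt (w e)
  lia

theorem cast_wdeg_val {V : Type} [Fintype V] {G : SimpleGraph V} {w : Sym2 V → ZMod 2}
    (hw : ∀ e ∉ G.edgeSet, w e = 0) (x : V) :
    (wdeg G (fun e => (w e).val) x : ZMod 2) = ∑ u, w s(x, u) := by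
  simp only [wdeg, Nat.cast_sum, ZMod.natCast_val, ZMod.cast_id', id_eq]
  refine Finset.sum_subset (Finset.filter_subset _ _) fun u _ hu => hw _ ?_
  simpa using hu

theorem wdeg_eq_of_degree_eq_one {V : Type} [Fintype V] {G : SimpleGraph V} {v v' : V}
    (hdeg : G.degree v = 1) (hadj : G.Adj v v') (w : Sym2 V → ℕ) :
    wdeg G w v = w s(v, v') := by
  obtain ⟨a, -, ha⟩ := SimpleGraph.degree_eq_one_iff_existsUnique_adj.mp hdeg
  have : Finset.univ.filter (fun u => G.Adj v u) = {v'} := by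
    ext u
    simp only [Finset.mem_filter, Finset.mem_univ, true_and, Finset.mem_singleton]
    exact ⟨fun h => (ha u h).trans (ha v' hadj).symm, fun h => h ▸ hadj⟩
  rw [wdeg, this, Finset.sum_singleton]

theorem le_wdeg {V : Type} [Fintype V] {G : SimpleGraph V} {x u : V} (h : G.Adj x u)
    (w : Sym2 V → ℕ) : w s(x, u) ≤ wdeg G w x :=
  Finset.single_le_sum (f := fun u => w s(x, u)) (fun _ _ => Nat.zero_le _) (by simpa using h)

/-- In a finite simple connected bipartite graph without the
`{0,1}`-property, if `v` is a vertex of degree `1` with (unique) neighbour `v'`, then every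
edge incident with `v'` is a bridge. -/
theorem statement11 {V : Type} [Fintype V] (G : SimpleGraph V) (hconn : G.Connected)
    (hbip : G.Colorable 2) (hbad : ¬ HasZeroOneProperty G)
    (v v' : V) (hdeg : G.degree v = 1) (hadj : G.Adj v v') :
    ∀ u : V, G.Adj v' u → G.IsBridge s(v', u) := by
  intro u hu
  by_contra hbridge
  obtain ⟨c⟩ := hbip
  let f : V → ZMod 2 := fun x => if c x = c v then 1 else 0
  have hf {x y : V} (h : G.Adj x y) : f x ≠ f y := by
    have hc := c.valid h
    have : c x = c v ∨ c y = c v := by lia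
    grind
  apply hbad
  obtain hsum | hsum : ∑ x, f x = 0 ∨ ∑ x, f x = 1 := by
    generalize ∑ x, f x = t; revert t; decide
  · obtain ⟨w, hw, hwf⟩ := IsDegreeParity.of_connected hconn hsum
    refine ⟨_, is01Weighting_val G w, fun x y hxy heq => hf hxy ?_⟩
    rw [← hwf, ← hwf, ← cast_wdeg_val hw, ← cast_wdeg_val hw, heq]
  let e : Sym2 V := s(v', u)
  obtain ⟨w₀, hw₀, hwf₀⟩ := IsDegreeParity.of_connected
    (hconn.connected_delete_edge_of_not_isBridge hbridge)
    (f := f + Pi.single v 1 + (Pi.single v' 1 + Pi.single u 1)) (by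
      simp only [Pi.add_apply, Finset.sum_add_distrib, hsum, Finset.sum_pi_single',
        Finset.mem_univ, if_true]
      decide)
  let w : Sym2 V → ZMod 2 := w₀ + Pi.single e 1
  have hw : ∀ e' ∉ G.edgeSet, w e' = 0 := by
    intro e' he'
    have hne : e' ≠ e := by rintro rfl; exact he' hu
    simp [w, hne, hw₀ e' (fun h => he' (SimpleGraph.edgeSet_mono (G.deleteEdges_le _) h))]
  have hwe : w e = 1 := by simp [w, hw₀ e (by simp [e])]
  have hwf (x : V) : ∑ y, w s(x, y) = f x + (Pi.single v 1 : V → ZMod 2) x := by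
    simp only [w, Pi.add_apply, Finset.sum_add_distrib, hwf₀, e, sum_single_edge hu.ne]
    rw [add_assoc, CharTwo.add_self_eq_zero, add_zero]
  have hleaf : wdeg G (fun e => (w e).val) v = 0 := by
    have h := cast_wdeg_val hw v
    rw [hwf, Pi.single_eq_same, wdeg_eq_of_degree_eq_one hdeg hadj, ZMod.natCast_zmod_val] at h
    rw [wdeg_eq_of_degree_eq_one hdeg hadj, h]
    simp [f, CharTwo.add_self_eq_zero]
  have hpos : 0 < wdeg G (fun e => (w e).val) v' := by
    refine lt_of_lt_of_le ?_ (le_wdeg hu _)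
    change 0 < (w e).val
    simp [hwe, ZMod.val_one]
  obtain ⟨a, -, ha⟩ := SimpleGraph.degree_eq_one_iff_existsUnique_adj.mp hdeg
  have huniq {y : V} (h : G.Adj v y) : y = v' := (ha y h).trans (ha v' hadj).symm
  refine ⟨_, is01Weighting_val G w, fun x y hxy heq => ?_⟩
  by_cases hx : x = v
  · subst hx
    rw [huniq hxy] at heq
    lia
  by_cases hy : y = v
  · subst hy
    rw [huniq hxy.symm] at heq
    lia
  have h := congrArg (Nat.cast : ℕ → ZMod 2) heq
  rw [cast_wdeg_val hw, cast_wdeg_val hw, hwf, hwf, Pi.single_eq_of_ne hx,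
    Pi.single_eq_of_ne hy, add_zero, add_zero] at h
  exact hf hxy h
end

section
/- Let G be a finite simple connected bipartite graph, let v be a vertex of degree 1 with unique neighbour v', and let e_0, e_1, …, e_n be the edges incident with v', where e_0 = vv'. Assume that every edge incident with v' is a bridge of G. For each i with 1 ≤ i ≤ n, let G_i be the component of G − e_i not containing v, and let G_i' be the graph obtained from G_i by adding the vertices v and v' and the edges e_0 and e_i (that is, G_i' is the subgraph of G induced by V(G_i) ∪ {v, v'}). Then G is bad if and only if every one of the graphs G_1', …, G_n' is bad. -/
open scoped Classical

/-- The weighted degree of `x` counting only the edges whose other end lies in `S`. -/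
noncomputable def wdegIn {V : Type} [Fintype V] (G : SimpleGraph V) (S : Set V)
    (w : Sym2 V → ℕ) (x : V) : ℕ :=
  ∑ y ∈ Finset.univ.filter (fun y => G.Adj x y ∧ y ∈ S), w s(x, y)

theorem wdeg_induce {V : Type} [Fintype V] (G : SimpleGraph V) (S : Set V) [Fintype S]
    (W : Sym2 V → ℕ) (x : S) :
    wdeg (G.induce S) (fun e => W (e.map Subtype.val)) x = wdegIn G S W x := by
  unfold wdeg wdegIn
  refine Finset.sum_bij (fun y _ => (y : V)) ?_ ?_ ?_ ?_
  · intro y hy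
    simpa using hy
  · intro a _ b _ h
    exact Subtype.ext h
  · intro b hb
    simp only [Finset.mem_filter, Finset.mem_univ, true_and] at hb
    exact ⟨⟨b, hb.2⟩, by simpa using hb.1, rfl⟩
  · intro a _
    simp

/-- Properness of a weighting of an induced subgraph, in terms of weightings of the host graph. -/
theorem hasZeroOneProperty_induce_iff {V : Type} [Fintype V] (G : SimpleGraph V) (S : Set V)
    [Fintype S] :
    HasZeroOneProperty (G.induce S) ↔
      ∃ W : Sym2 V → ℕ, (∀ x ∈ S, ∀ y ∈ S, G.Adj x y → W s(x, y) = 0 ∨ W s(x, y) = 1) ∧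
        ∀ x ∈ S, ∀ y ∈ S, G.Adj x y → wdegIn G S W x ≠ wdegIn G S W y := by
  constructor
  · rintro ⟨w, hw, hp⟩
    have hinj : Function.Injective (Sym2.map (Subtype.val : S → V)) :=
      Sym2.map.injective Subtype.val_injective
    have hW : w = fun e => Function.extend (Sym2.map (Subtype.val : S → V)) w 0
        (e.map Subtype.val) := by
      funext e
      exact (hinj.extend_apply w 0 e).symm
    refine ⟨Function.extend (Sym2.map (Subtype.val : S → V)) w 0, ?_, ?_⟩
    · intro x hx y hy hxy
      have h := hw s(⟨x, hx⟩, ⟨y, hy⟩) (by simpa using hxy)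
      rw [hW] at h
      exact h
    · intro x hx y hy hxy
      have h := @hp ⟨x, hx⟩ ⟨y, hy⟩ (by simpa using hxy)
      rw [hW, wdeg_induce, wdeg_induce] at h
      exact h
  · rintro ⟨W, hW, hp⟩
    refine ⟨fun e => W (e.map Subtype.val), ?_, ?_⟩
    · intro e
      induction e with
      | _ x y => exact fun h => hW x x.2 y y.2 (by simpa using h)
    · intro x y hxy
      rw [wdeg_induce, wdeg_induce]
      exact hp x x.2 y y.2 (by simpa using hxy)

/-- In a connected graph every parity prescription off a root vertex is realised by an edge
weighting. -/
theorem exists_weighting_of_parity {V : Type} [Fintype V] {G : SimpleGraph V}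
    (hconn : G.Connected) (r : V) (p : V → ZMod 2) :
    ∃ w : Sym2 V → ℕ, (∀ e, w e = 0 ∨ w e = 1) ∧
      ∀ x, x ≠ r → (wdeg G w x : ZMod 2) = p x := by
  let bd : (Sym2 V → ZMod 2) → V → ZMod 2 :=
    fun f x => ∑ y ∈ Finset.univ.filter (fun y => G.Adj x y), f s(x, y)
  have edge : ∀ a b, G.Adj a b → ∃ f, bd f = Pi.single a 1 + Pi.single b 1 := by
    intro a b hab
    refine ⟨Pi.single s(a, b) 1, ?_⟩
    funext x
    simp only [bd]
    by_cases hxa : x = a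
    · subst hxa
      rw [Finset.sum_eq_single_of_mem b (by simpa using hab)]
      · simp [hab.ne]
      · intro y _ hy
        simp [hy, hab.ne]
    · by_cases hxb : x = b
      · subst hxb
        rw [Finset.sum_eq_single_of_mem a (by simpa using hab.symm)]
        · simp [Sym2.eq_swap (a := x), hxa]
        · intro y _ hy
          simp [hy, hxa]
      · rw [Finset.sum_eq_zero fun y _ => by simp [hxa, hxb]]
        simp [hxa, hxb]
  have two : ∀ f : V → ZMod 2, f + f = 0 := fun f => funext fun x =>
    CharTwo.add_self_eq_zero (f x)
  have bd_add : ∀ f g, bd (f + g) = bd f + bd g := by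
    intro f g
    funext x
    simp [bd, Finset.sum_add_distrib]
  have point : ∀ x, ∃ f, bd f = Pi.single x 1 + Pi.single r 1 := by
    intro x
    obtain ⟨q⟩ := hconn.preconnected x r
    induction q with
    | nil =>
      refine ⟨0, ?_⟩
      rw [two]
      funext y
      simp [bd]
    | cons h _ ih =>
      obtain ⟨f, hf⟩ := ih
      obtain ⟨g, hg⟩ := edge _ _ h
      refine ⟨g + f, ?_⟩
      rw [bd_add, hf, hg, add_assoc, ← add_assoc (Pi.single _ 1) (Pi.single _ 1) (Pi.single _ 1),
        two, zero_add]
  choose F hF using point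
  have key : ∀ x, x ≠ r → bd (∑ z, p z • F z) x = p x := by
    intro x hx
    have : bd (∑ z, p z • F z) x = ∑ z, p z * bd (F z) x := by
      simp only [bd, Finset.sum_apply, Pi.smul_apply, smul_eq_mul, Finset.mul_sum]
      exact Finset.sum_comm
    rw [this]
    simp [hF, Pi.single_apply, hx]
  refine ⟨fun e => ((∑ z, p z • F z) e).val, ?_, ?_⟩
  · intro e
    have := ZMod.val_lt ((∑ z, p z • F z) e)
    dsimp only
    omega
  · intro x hx
    rw [← key x hx]
    simp only [wdeg, bd, Nat.cast_sum, ZMod.natCast_val, ZMod.cast_id', id_eq]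

/-- `C` is a side of the bridge `v'u` in `G`, containing `u` but not the leaf `v` at `v'`. -/
structure IsBranch {V : Type} (G : SimpleGraph V) (v v' u : V) (C : Set V) : Prop where
  root_mem : u ∈ C
  leaf_notMem : v ∉ C
  hub_notMem : v' ∉ C
  closed : ∀ x ∈ C, ∀ y, G.Adj x y → y ∈ C ∨ y = v'
  root_unique : ∀ y ∈ C, G.Adj v' y → y = u

theorem isBranch_of_isBridge {V : Type} {G : SimpleGraph V} {v v' u : V} (hadj : G.Adj v v')
    (huv : u ≠ v) (hbr : G.IsBridge s(v', u)) :
    IsBranch G v v' u {x : V | (G.deleteEdges {s(v', u)}).Reachable u x} := by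
  have hub : ¬ (G.deleteEdges {s(v', u)}).Reachable u v' := fun h =>
    (SimpleGraph.isBridge_iff.1 hbr) h.symm
  have step : ∀ {x y}, (G.deleteEdges {s(v', u)}).Reachable u x → G.Adj x y →
      s(x, y) ≠ s(v', u) → (G.deleteEdges {s(v', u)}).Reachable u y := fun hx hxy hne =>
    hx.trans (SimpleGraph.Adj.reachable (SimpleGraph.deleteEdges_adj.2 ⟨hxy, hne⟩))
  refine ⟨SimpleGraph.Reachable.refl _, fun h => hub ?_, hub, ?_, ?_⟩
  · refine step h hadj fun he => ?_
    rcases Sym2.eq_iff.1 he with h | h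
    · exact hadj.ne h.1
    · exact huv h.1.symm
  · intro x hx y hxy
    by_cases h : s(x, y) = s(v', u)
    · rcases Sym2.eq_iff.1 h with h | h
      · exact absurd (h.1 ▸ hx) hub
      · exact Or.inr h.2
    · exact Or.inl (step hx hxy h)
  · intro y hy hadj'
    by_contra hne
    refine hub (step hy hadj'.symm fun h => ?_)
    rcases Sym2.eq_iff.1 h with h | h
    · exact hub (h.1 ▸ hy)
    · exact hne h.1

theorem wdegIn_branch {V : Type} [Fintype V] {G : SimpleGraph V} {v v' u : V} {C : Set V}
    (hC : IsBranch G v v' u C) (W : Sym2 V → ℕ) {x : V} (hx : x ∈ C) :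
    wdegIn G (C ∪ {v, v'}) W x = wdeg G W x := by
  unfold wdegIn wdeg
  congr 1
  ext y
  simp only [Finset.mem_filter, Finset.mem_univ, true_and, and_iff_left_iff_imp]
  intro h
  rcases hC.closed x hx y h with h | h <;> simp [h]

theorem wdeg_leaf {V : Type} [Fintype V] {G : SimpleGraph V} {v v' : V} (hadj : G.Adj v v')
    (hleaf : ∀ y, G.Adj v y → y = v') (W : Sym2 V → ℕ) : wdeg G W v = W s(v, v') := by
  have : Finset.univ.filter (fun y => G.Adj v y) = {v'} := by
    ext y
    simpa using ⟨hleaf y, fun h => h ▸ hadj⟩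
  unfold wdeg
  convert Finset.sum_singleton (fun y => W s(v, y)) v' using 2

theorem wdegIn_leaf {V : Type} [Fintype V] {G : SimpleGraph V} {v v' : V} (hadj : G.Adj v v')
    (hleaf : ∀ y, G.Adj v y → y = v') (C : Set V) (W : Sym2 V → ℕ) :
    wdegIn G (C ∪ {v, v'}) W v = W s(v, v') := by
  rw [← wdeg_leaf hadj hleaf W]
  unfold wdegIn wdeg
  congr 1
  ext y
  simp only [Finset.mem_filter, Finset.mem_univ, true_and, and_iff_left_iff_imp]
  intro h
  simp [hleaf y h]

theorem wdegIn_hub {V : Type} [Fintype V] {G : SimpleGraph V} {v v' u : V} {C : Set V}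
    (hC : IsBranch G v v' u C) (hadj : G.Adj v v') (hu : G.Adj v' u) (W : Sym2 V → ℕ) :
    wdegIn G (C ∪ {v, v'}) W v' = W s(v, v') + W s(v', u) := by
  have hne : v ≠ u := fun h => hC.leaf_notMem (h ▸ hC.root_mem)
  have : Finset.univ.filter (fun y => G.Adj v' y ∧ y ∈ C ∪ {v, v'}) = {v, u} := by
    ext y
    simp only [Finset.mem_filter, Finset.mem_univ, true_and, Finset.mem_insert,
      Finset.mem_singleton, Set.mem_union, Set.mem_insert_iff, Set.mem_singleton_iff]
    constructor
    · rintro ⟨h, hy | rfl | rfl⟩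
      · exact Or.inr (hC.root_unique y hy h)
      · exact Or.inl rfl
      · exact absurd h (G.irrefl)
    · rintro (rfl | rfl)
      · exact ⟨hadj.symm, Or.inr (Or.inl rfl)⟩
      · exact ⟨hu, Or.inl hC.root_mem⟩
  rw [Sym2.eq_swap, ← Finset.sum_pair (f := fun y => W s(v', y)) hne, ← this]
  unfold wdegIn
  congr!

/-- A weighting whose edge `v'u` has weight `1` and which is proper inside the branch at `u`
yields a proper weighting of the branch together with `v` and `v'`. -/
theorem hasZeroOneProperty_branch {V : Type} [Fintype V] {G : SimpleGraph V} {v v' u : V}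
    {C : Set V} [Fintype ↥(C ∪ {v, v'})] (hC : IsBranch G v v' u C) (hadj : G.Adj v v')
    (hleaf : ∀ y, G.Adj v y → y = v') (hu : G.Adj v' u) {W : Sym2 V → ℕ}
    (hW : Is01Weighting G W) (hp : ∀ ⦃x y⦄, G.Adj x y → wdeg G W x ≠ wdeg G W y)
    (h1 : W s(v', u) = 1) : HasZeroOneProperty (G.induce (C ∪ {v, v'})) := by
  rw [hasZeroOneProperty_induce_iff]
  obtain ⟨a, ha, hau⟩ : ∃ a, (a = 0 ∨ a = 1) ∧ a + 1 ≠ wdeg G W u := by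
    by_cases h : wdeg G W u = 1
    · exact ⟨1, by simp, by omega⟩
    · exact ⟨0, by simp, by omega⟩
  set W' : Sym2 V → ℕ := Function.update W s(v, v') a with hW'
  have hC' : ∀ x ∈ C, wdegIn G (C ∪ {v, v'}) W' x = wdeg G W x := by
    intro x hx
    rw [wdegIn_branch hC _ hx]
    refine Finset.sum_congr rfl fun y _ => ?_
    refine Function.update_of_ne (fun h => ?_) _ _
    rcases Sym2.eq_iff.1 h with h | h
    · exact hC.leaf_notMem (h.1 ▸ hx)
    · exact hC.hub_notMem (h.1 ▸ hx)
  have hv : wdegIn G (C ∪ {v, v'}) W' v = a := by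
    rw [wdegIn_leaf hadj hleaf, hW', Function.update_self]
  have hv' : wdegIn G (C ∪ {v, v'}) W' v' = a + 1 := by
    rw [wdegIn_hub hC hadj hu, hW', Function.update_self, Function.update_of_ne, h1]
    intro h
    rcases Sym2.eq_iff.1 h with h | h
    · exact hadj.ne h.1.symm
    · exact hC.leaf_notMem (h.2 ▸ hC.root_mem)
  refine ⟨W', ?_, ?_⟩
  · intro x _ y _ hxy
    by_cases h : s(x, y) = s(v, v')
    · rw [h, hW', Function.update_self]
      exact ha
    · rw [hW', Function.update_of_ne h]
      exact hW _ hxy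
  · have hub : ∀ y ∈ C ∪ {v, v'}, G.Adj v' y →
        wdegIn G (C ∪ {v, v'}) W' v' ≠ wdegIn G (C ∪ {v, v'}) W' y := by
      rintro y (hy | rfl | rfl) h
      · rw [hv', hC' y hy, hC.root_unique y hy h]
        exact hau
      · omega
      · exact absurd h G.irrefl
    intro x hx y hy hxy
    by_cases hx' : x = v'
    · subst hx'
      exact hub y hy hxy
    by_cases hy' : y = v'
    · subst hy'
      exact (hub x hx hxy.symm).symm
    have mem : ∀ z ∈ C ∪ {v, v'}, z ≠ v' → z ≠ v → z ∈ C := by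
      rintro z (hz | rfl | rfl) h h'
      exacts [hz, absurd rfl h', absurd rfl h]
    have hxC := mem x hx hx' fun h => hy' (hleaf y (h ▸ hxy))
    have hyC := mem y hy hy' fun h => hx' (hleaf x (h ▸ hxy.symm))
    rw [hC' x hxC, hC' y hyC]
    exact hp hxy

/-- A proper weighting gives weight `1` to some edge at `v'` other than the pendant edge `vv'`. -/
theorem exists_weight_one {V : Type} [Fintype V] {G : SimpleGraph V} {v v' : V}
    (hadj : G.Adj v v') (hleaf : ∀ y, G.Adj v y → y = v') {W : Sym2 V → ℕ}
    (hW : Is01Weighting G W) (hne : wdeg G W v' ≠ wdeg G W v) :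
    ∃ u, G.Adj v' u ∧ u ≠ v ∧ W s(v', u) = 1 := by
  by_contra! hcon
  refine hne ?_
  rw [wdeg_leaf hadj hleaf, Sym2.eq_swap]
  refine Finset.sum_eq_single v (fun y hy hyv => ?_) (fun h => ?_)
  · have hy' : G.Adj v' y := by simpa using hy
    exact (hW _ hy').resolve_right (hcon y hy' hyv)
  · simp [hadj.symm] at h

/-- A proper weighting of one branch with `v` and `v'` extends to `G`. -/
theorem hasZeroOneProperty_of_branch {V : Type} [Fintype V] {G : SimpleGraph V}
    (hconn : G.Connected) (hbip : G.Colorable 2) {v v' u : V}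
    {C : Set V} [Fintype ↥(C ∪ {v, v'})] (hC : IsBranch G v v' u C) (hadj : G.Adj v v')
    (hleaf : ∀ y, G.Adj v y → y = v') (hu : G.Adj v' u)
    (h : HasZeroOneProperty (G.induce (C ∪ {v, v'}))) : HasZeroOneProperty G := by
  by_contra hbad
  obtain ⟨W, hW, hp⟩ := (hasZeroOneProperty_induce_iff G _).1 h
  obtain ⟨c⟩ := hbip
  have hvS : v ∈ C ∪ {v, v'} := by simp
  have hv'S : v' ∈ C ∪ {v, v'} := by simp
  have huS : u ∈ C ∪ {v, v'} := Or.inl hC.root_mem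
  have hWu : W s(v', u) = 1 := by
    refine (hW v' hv'S u huS hu).resolve_left fun h0 => hp v hvS v' hv'S hadj ?_
    rw [wdegIn_leaf hadj hleaf, wdegIn_hub hC hadj hu, h0, add_zero]
  have hcol : ∀ x y, G.Adj x y → ((c x : ℕ) : ZMod 2) ≠ ((c y : ℕ) : ZMod 2) := by
    intro x y hxy heq
    have hval := c.valid hxy
    generalize c x = i at *
    generalize c y = j at *
    revert i j
    decide
  obtain ⟨w, hw, hwp⟩ := exists_weighting_of_parity hconn v
    (fun x => ((c x : ℕ) : ZMod 2) + ((c v' : ℕ) : ZMod 2) + (W s(v, v') + 1 : ℕ))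
  have hwv' : (wdeg G w v' : ZMod 2) = (W s(v, v') + 1 : ℕ) := by
    rw [hwp v' hadj.ne', CharTwo.add_self_eq_zero, zero_add]
  have hproper : ∀ x y, G.Adj x y → x ≠ v → y ≠ v →
      (wdeg G w x : ZMod 2) ≠ (wdeg G w y : ZMod 2) := by
    intro x y hxy hx hy heq
    rw [hwp x hx, hwp y hy] at heq
    exact hcol x y hxy (add_right_cancel (add_right_cancel heq))
  have heq : wdeg G w v' = wdeg G w v := by
    by_contra hne
    refine hbad ⟨w, fun e _ => hw e, fun x y hxy => ?_⟩
    by_cases hx : x = v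
    · subst hx
      rw [hleaf y hxy]
      exact Ne.symm hne
    by_cases hy : y = v
    · subst hy
      rw [hleaf x hxy.symm]
      exact hne
    exact fun h => hproper x y hxy hx hy (by rw [h])
  have hzero : ∀ y, G.Adj v' y → y ≠ v → w s(v', y) = 0 := by
    intro y hy hyv
    have hsum : wdeg G w v' = w s(v', v) +
        ∑ z ∈ (Finset.univ.filter (fun z => G.Adj v' z)).erase v, w s(v', z) :=
      (Finset.add_sum_erase _ (fun z => w s(v', z)) (by simpa using hadj.symm)).symm
    rw [heq, wdeg_leaf hadj hleaf, Sym2.eq_swap] at hsum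
    have h0 : ∑ z ∈ (Finset.univ.filter (fun z => G.Adj v' z)).erase v, w s(v', z) = 0 := by
      omega
    exact Finset.sum_eq_zero_iff.1 h0 y (by simp [hy, hyv])
  set S : Set V := C ∪ {v, v'}
  let g : Sym2 V → ℕ := fun e => if ∀ x ∈ e, x ∈ S then W e else w e
  have gin : ∀ x ∈ S, ∀ y ∈ S, g s(x, y) = W s(x, y) := by
    intro x hx y hy
    simp [g, hx, hy]
  have gout : ∀ x y, y ∉ S → g s(x, y) = w s(x, y) := by
    intro x y hy
    simp [g, hy]
  have gdeg : ∀ x ∈ S, wdeg G g x = wdegIn G S W x := by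
    intro x hx
    have hsub : wdegIn G S g x = wdegIn G S W x := by
      refine Finset.sum_congr rfl fun y hy => gin x hx y ?_
      simp only [Finset.mem_filter] at hy
      exact hy.2.2
    rw [← hsub]
    symm
    refine Finset.sum_subset (fun y hy => ?_) (fun y hy hyn => ?_)
    · simp only [Finset.mem_filter, Finset.mem_univ, true_and] at hy ⊢
      exact hy.1
    · simp only [Finset.mem_filter, Finset.mem_univ, true_and] at hy hyn
      have hyS : y ∉ S := fun h => hyn ⟨hy, h⟩
      have hxv' : x = v' := by
        rcases hx with hx | rfl | rfl
        · rcases hC.closed x hx y hy with h | h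
          · exact absurd (Or.inl h) hyS
          · exact absurd (h ▸ hv'S) hyS
        · exact absurd (hleaf y hy ▸ hv'S) hyS
        · rfl
      subst hxv'
      rw [gout _ _ hyS]
      exact hzero y hy fun h => hyS (h ▸ hvS)
  have gdeg' : ∀ x, x ∉ S → wdeg G g x = wdeg G w x := by
    intro x hx
    refine Finset.sum_congr rfl fun y _ => ?_
    rw [Sym2.eq_swap, gout _ _ hx]
  have hub : wdeg G g v' = W s(v, v') + 1 := by
    rw [gdeg v' hv'S, wdegIn_hub hC hadj hu, hWu]
  have cross : ∀ x ∈ S, ∀ y, y ∉ S → G.Adj x y → wdeg G g x ≠ wdeg G g y := by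
    intro x hx y hy hxy
    have hxv' : x = v' := by
      rcases hx with hx | rfl | rfl
      · rcases hC.closed x hx y hxy with h | h
        · exact absurd (Or.inl h) hy
        · exact absurd (h ▸ hv'S) hy
      · exact absurd (hleaf y hxy ▸ hv'S) hy
      · rfl
    subst hxv'
    rw [hub, gdeg' y hy]
    intro h
    refine hproper x y hxy hadj.ne' (fun h => hy (h ▸ hvS)) ?_
    rw [hwv', h]
  refine hbad ⟨g, fun e he => ?_, fun x y hxy => ?_⟩
  · induction e with
    | _ x y =>
      by_cases hx : x ∈ S
      · by_cases hy : y ∈ S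
        · rw [gin x hx y hy]
          exact hW x hx y hy he
        · rw [gout x y hy]
          exact hw _
      · rw [Sym2.eq_swap, gout y x hx]
        exact hw _
  · by_cases hx : x ∈ S
    · by_cases hy : y ∈ S
      · rw [gdeg x hx, gdeg y hy]
        exact hp x hx y hy hxy
      · exact cross x hx y hy hxy
    · by_cases hy : y ∈ S
      · exact (cross y hy x hx hxy.symm).symm
      · rw [gdeg' x hx, gdeg' y hy]
        exact fun h => hproper x y hxy (fun h => hx (h ▸ hvS)) (fun h => hy (h ▸ hvS)) (by rw [h])

/-- Let `G` be a finite simple connected bipartite graph, `v` a vertex of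
degree `1` with unique neighbour `v'`, and suppose every edge incident with `v'` is a
bridge. For each neighbour `u ≠ v` of `v'`, let `G_u'` be the subgraph of `G` induced by the
vertex set of the component of `G - v'u` not containing `v` (the vertices reachable from `u`
after deleting the edge `v'u`) together with `v` and `v'`. Then `G` is bad if and only if
all the graphs `G_u'` are bad. -/
theorem statement12 {V : Type} [Fintype V] (G : SimpleGraph V) (hconn : G.Connected)
    (hbip : G.Colorable 2) (v v' : V) (hdeg : G.degree v = 1) (hadj : G.Adj v v')
    (hbr : ∀ u : V, G.Adj v' u → G.IsBridge s(v', u)) :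
    ¬ HasZeroOneProperty G ↔
      ∀ u : V, G.Adj v' u → u ≠ v →
        ¬ HasZeroOneProperty
            (G.induce ({x : V | (G.deleteEdges {s(v', u)}).Reachable u x} ∪ {v, v'})) := by
  have hleaf : ∀ y, G.Adj v y → y = v' := by
    intro y hy
    obtain ⟨z, _, hz⟩ := SimpleGraph.degree_eq_one_iff_existsUnique_adj.1 hdeg
    rw [hz y hy, hz v' hadj]
  constructor
  · intro hbad u hu huv h
    exact hbad (hasZeroOneProperty_of_branch hconn hbip
      (isBranch_of_isBridge hadj huv (hbr u hu)) hadj hleaf hu h)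
  · rintro hall ⟨W, hW, hp⟩
    obtain ⟨u, hu, huv, h1⟩ := exists_weight_one hadj hleaf hW (hp hadj.symm)
    exact hall u hu huv (hasZeroOneProperty_branch
      (isBranch_of_isBridge hadj huv (hbr u hu)) hadj hleaf hu hW hp h1)
end

section
/- Let s be a non-negative integer and let G be a G_v(s,s+3)-tree with distinguished vertex v. Then the components of G − v can be classified as follows: exactly two components T1 and T2, whose unique vertices v1 and v2 adjacent to v in G satisfy that T1 is a G_{v1}(s+1,s+2)-tree and T2 is a G_{v2}(s+1,s+2)-tree; exactly s components that are bad trees; and every remaining component T, whose unique vertex u is adjacent to v in G, is a G_u(−)-tree. Equivalently, G is obtained from the disjoint union of a G_{v1}(s+1,s+2)-tree and a G_{v2}(s+1,s+2)-tree, together with a number of G_{v_i}(−)-trees and s bad trees, by adding the vertex v, the edges from v to each of the distinguished vertices v1, v2 and v_i, and one edge from v to each of the s bad trees. -/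
open scoped Classical

/-- The vertex set of the component of `G - v` containing `u`: all vertices reachable
from `u` after deleting every edge incident with `v`. -/
def compSet {V : Type} (G : SimpleGraph V) (v u : V) : Set V :=
  {x | (G.deleteEdges {e : Sym2 V | v ∈ e}).Reachable u x}

/-- The vertex `u`, as a vertex of the component of `G - v` containing it. -/
def compVert {V : Type} (G : SimpleGraph V) (v u : V) : ↥(compSet G v u) :=
  ⟨u, SimpleGraph.Reachable.refl u⟩

/-- The weighted degrees of `v` under the proper `{0,1}`-weightings of `G`. -/
def plainColours {V : Type} [Fintype V] (G : SimpleGraph V) (v : V) : Set ℕ :=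
  {c | ∃ w : Sym2 V → ℕ, Is01Weighting G w ∧
    (∀ ⦃x y : V⦄, G.Adj x y → wdeg G w x ≠ wdeg G w y) ∧ wdeg G w v = c}

/-- The increased weighted degrees of `v` under the `{0,1}`-weightings of `G` which are proper
when the weighted degree of `v` is increased by `1`. -/
def shiftedColours {V : Type} [Fintype V] (G : SimpleGraph V) (v : V) : Set ℕ :=
  {c | ∃ w : Sym2 V → ℕ, Is01Weighting G w ∧
    (∀ ⦃x y : V⦄, G.Adj x y → wdegPlus G w v x ≠ wdegPlus G w v y) ∧ wdeg G w v + 1 = c}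

lemma gvAB_iff {V : Type} [Fintype V] (G : SimpleGraph V) (v : V) (a b : ℕ) :
    GvAB G v a b ↔ plainColours G v ⊆ {a} ∧ shiftedColours G v ⊆ {b} := by
  constructor
  · rintro ⟨h₁, h₂⟩
    exact ⟨fun c ⟨w, hw, hp, hc⟩ => hc ▸ h₁ w hw hp, fun c ⟨w, hw, hp, hc⟩ => hc ▸ h₂ w hw hp⟩
  · rintro ⟨h₁, h₂⟩
    exact ⟨fun w hw hp => h₁ ⟨w, hw, hp, rfl⟩, fun w hw hp => h₂ ⟨w, hw, hp, rfl⟩⟩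

lemma not_hasZeroOneProperty {V : Type} [Fintype V] {G : SimpleGraph V} {v : V}
    (h : plainColours G v = ∅) : ¬ HasZeroOneProperty G := by
  rintro ⟨w, hw, hp⟩
  exact Set.eq_empty_iff_forall_notMem.1 h _ ⟨w, hw, hp, rfl⟩

lemma gvMinus_of_shiftedColours_eq_empty {V : Type} [Fintype V] {G : SimpleGraph V} {v : V}
    (h : shiftedColours G v = ∅) : GvMinus G v := by
  rintro ⟨w, hw, hp⟩
  exact Set.eq_empty_iff_forall_notMem.1 h _ ⟨w, hw, hp, rfl⟩

/-! ### Prescribing the parities of the weighted degrees -/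

/-- The map sending an edge-weighting over `ZMod 2` to its weighted degrees. -/
noncomputable def degreeMap {V : Type} [Fintype V] (G : SimpleGraph V) :
    (Sym2 V → ZMod 2) →ₗ[ZMod 2] (V → ZMod 2) where
  toFun w x := ∑ u ∈ Finset.univ.filter (fun u => G.Adj x u), w s(x, u)
  map_add' w w' := by ext x; simp [Finset.sum_add_distrib]
  map_smul' c w := by ext x; simp [Finset.mul_sum]

lemma single_add_single_mem_range_of_adj {V : Type} [Fintype V] {G : SimpleGraph V} {a b : V}
    (h : G.Adj a b) :
    (Pi.single a 1 + Pi.single b 1 : V → ZMod 2) ∈ LinearMap.range (degreeMap G) := by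
  refine ⟨Pi.single s(a, b) 1, ?_⟩
  ext x
  have hab := h.ne
  simp only [degreeMap, LinearMap.coe_mk, AddHom.coe_mk, Pi.add_apply, Pi.single_apply,
    Sym2.eq_iff]
  by_cases hxa : x = a
  · subst hxa
    simp [h, hab]
  · by_cases hxb : x = b
    · subst hxb
      simp [hxa, h.symm]
    · simp [hxa, hxb]

lemma single_add_single_mem_range_of_reachable {V : Type} [Fintype V] {G : SimpleGraph V}
    {a b : V} (h : G.Reachable a b) :
    (Pi.single a 1 + Pi.single b 1 : V → ZMod 2) ∈ LinearMap.range (degreeMap G) := by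
  rw [SimpleGraph.reachable_iff_reflTransGen] at h
  have hself : ∀ f : V → ZMod 2, f + f = 0 := fun f => funext fun _ => CharTwo.add_self_eq_zero _
  induction h with
  | refl => rw [hself]; exact Submodule.zero_mem _
  | @tail b c _ hbc ih =>
    have := Submodule.add_mem _ ih (single_add_single_mem_range_of_adj hbc)
    rwa [add_assoc, ← add_assoc (Pi.single b 1 : V → ZMod 2), hself, zero_add] at this

lemma mem_range_degreeMap {V : Type} [Fintype V] {G : SimpleGraph V} (hG : G.Connected)
    {t : V → ZMod 2} (ht : ∑ x, t x = 0) : t ∈ LinearMap.range (degreeMap G) := by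
  obtain ⟨r⟩ := hG.nonempty
  have key : t = ∑ x, t x • (Pi.single x 1 + Pi.single r 1 : V → ZMod 2) := by
    simp only [smul_add, Finset.sum_add_distrib, ← Finset.sum_smul, ht, zero_smul, add_zero]
    ext y
    simp [Finset.sum_apply, Pi.single_apply]
  rw [key]
  exact Submodule.sum_mem _ fun x _ => Submodule.smul_mem _ _
    (single_add_single_mem_range_of_reachable (hG.preconnected x r))

lemma exists_weighting_parity {V : Type} [Fintype V] {G : SimpleGraph V} (hG : G.Connected)
    {t : V → ZMod 2} (ht : ∑ x, t x = 0) :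
    ∃ w : Sym2 V → ℕ, Is01Weighting G w ∧ ∀ x, (wdeg G w x : ZMod 2) = t x := by
  obtain ⟨w, rfl⟩ := mem_range_degreeMap hG ht
  refine ⟨fun e => (w e).val, fun e _ => ?_, fun x => ?_⟩
  · have := (w e).val_lt
    change (w e).val = 0 ∨ (w e).val = 1
    omega
  · simp [wdeg, degreeMap]

/-- In a connected bipartite graph, the plain and the shifted colours of a vertex together
contain both parities. -/
lemma exists_colour_parity {V : Type} [Fintype V] {G : SimpleGraph V} (hG : G.Connected)
    (c : V → ZMod 2) (hc : ∀ ⦃x y⦄, G.Adj x y → c x ≠ c y) (v : V) (q : ZMod 2) :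
    ∃ d ∈ plainColours G v ∪ shiftedColours G v, (d : ZMod 2) = q := by
  set t : V → ZMod 2 := fun x => c x + (q - c v) with htdef
  have htv : t v = q := by simp [htdef]
  have ht : ∀ ⦃x y⦄, G.Adj x y → t x ≠ t y := fun x y h e => hc h (add_right_cancel e)
  have h2 : ∀ z : ZMod 2, z = 0 ∨ z + 1 = 0 := by decide
  rcases h2 (∑ x, t x) with h0 | h1
  · obtain ⟨w, hw, hwt⟩ := exists_weighting_parity hG h0
    refine ⟨wdeg G w v, Or.inl ⟨w, hw, fun x y h e => ht h ?_, rfl⟩, by rw [hwt, htv]⟩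
    rw [← hwt, ← hwt, e]
  · obtain ⟨w, hw, hwt⟩ := exists_weighting_parity hG (t := t + Pi.single v 1)
      (by simp [Finset.sum_add_distrib, h1])
    have hplus : ∀ x, (wdegPlus G w v x : ZMod 2) = t x := by
      intro x
      simp only [wdegPlus, Nat.cast_add, hwt, Pi.add_apply, Pi.single_apply]
      split_ifs <;> simp [add_assoc, CharTwo.add_self_eq_zero]
    refine ⟨wdeg G w v + 1, Or.inr ⟨w, hw, fun x y h e => ht h ?_, rfl⟩, ?_⟩
    · rw [← hplus, ← hplus, e]
    · have := hplus v
      simpa [wdegPlus, htv] using this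

lemma exists_colour_ne {V : Type} [Fintype V] {G : SimpleGraph V} (hG : G.Connected)
    (c : V → ZMod 2) (hc : ∀ ⦃x y⦄, G.Adj x y → c x ≠ c y) (v : V) (d : ℕ) :
    ∃ d' ∈ plainColours G v ∪ shiftedColours G v, d' ≠ d := by
  obtain ⟨d', hd', h⟩ := exists_colour_parity hG c hc v (d + 1)
  refine ⟨d', hd', ?_⟩
  rintro rfl
  simp at h

/-! ### The components of a tree minus a vertex -/

lemma notMem_compSet {V : Type} {G : SimpleGraph V} {v u : V} (h : G.Adj v u) :
    v ∉ compSet G v u := by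
  intro hv
  obtain ⟨p⟩ := hv.symm
  cases p with
  | nil => exact h.ne rfl
  | cons h' _ => simp [SimpleGraph.deleteEdges_adj] at h'

lemma ne_of_mem_compSet {V : Type} {G : SimpleGraph V} {v u x : V} (h : G.Adj v u)
    (hx : x ∈ compSet G v u) : x ≠ v := by
  rintro rfl
  exact notMem_compSet h hx

lemma mem_compSet_of_adj {V : Type} {G : SimpleGraph V} {v u x y : V} (hx : x ∈ compSet G v u)
    (hxy : G.Adj x y) (hxv : x ≠ v) (hyv : y ≠ v) : y ∈ compSet G v u := by
  refine SimpleGraph.Reachable.trans hx (SimpleGraph.Adj.reachable ?_)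
  simp [SimpleGraph.deleteEdges_adj, hxy, hxv.symm, hyv.symm]

lemma exists_mem_compSet {V : Type} {G : SimpleGraph V} (hG : G.Connected) {v x : V}
    (hx : x ≠ v) : ∃ u, G.Adj v u ∧ x ∈ compSet G v u := by
  have h := hG.preconnected v x
  rw [SimpleGraph.reachable_iff_reflTransGen] at h
  induction h with
  | refl => exact absurd rfl hx
  | @tail y z _ hyz ih =>
    by_cases hy : y = v
    · subst hy
      exact ⟨z, hyz, SimpleGraph.Reachable.refl z⟩
    · obtain ⟨u, hu, hyu⟩ := ih hy
      exact ⟨u, hu, mem_compSet_of_adj hyu hyz hy hx⟩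

lemma eq_of_mem_compSet {V : Type} {G : SimpleGraph V} (hG : G.IsAcyclic) {v u u' x : V}
    (hu : G.Adj v u) (hu' : G.Adj v u') (hx : x ∈ compSet G v u) (hx' : x ∈ compSet G v u') :
    u = u' := by
  by_contra hne
  have hb := SimpleGraph.isAcyclic_iff_forall_adj_isBridge.1 hG hu
  rw [SimpleGraph.isBridge_iff] at hb
  apply hb
  have h₁ : (G.deleteEdges {s(v, u)}).Reachable u' u := by
    refine (SimpleGraph.Reachable.trans hx' (SimpleGraph.Reachable.symm hx)).mono ?_
    intro a b hab
    simp only [SimpleGraph.deleteEdges_adj, Set.mem_ofPred_eq, Sym2.mem_iff] at hab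
    simp only [SimpleGraph.deleteEdges_adj, Set.mem_singleton_iff, Sym2.eq_iff]
    grind
  refine SimpleGraph.Reachable.trans (SimpleGraph.Adj.reachable ?_) h₁
  simp only [SimpleGraph.deleteEdges_adj, Set.mem_singleton_iff, Sym2.eq_iff]
  grind

lemma connected_induce_compSet {V : Type} (G : SimpleGraph V) (v u : V) :
    (G.induce (compSet G v u)).Connected := by
  have key : ∀ x (hx : x ∈ compSet G v u),
      (G.induce (compSet G v u)).Reachable (compVert G v u) ⟨x, hx⟩ := by
    intro x hx
    have h := hx
    simp only [compSet, Set.mem_ofPred_eq, SimpleGraph.reachable_iff_reflTransGen] at h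
    induction h with
    | refl => exact SimpleGraph.Reachable.refl _
    | @tail y z hy hyz ih =>
      have hy' : y ∈ compSet G v u := (SimpleGraph.reachable_iff_reflTransGen _ _).2 hy
      refine (ih hy').trans (SimpleGraph.Adj.reachable ?_)
      exact ((SimpleGraph.deleteEdges_adj ..).1 hyz).1
  refine SimpleGraph.connected_iff_exists_forall_reachable _ |>.2 ⟨compVert G v u, ?_⟩
  rintro ⟨x, hx⟩
  exact key x hx

/-- Extension by `0` of an edge-weighting of an induced subgraph. -/
noncomputable def extendWeight {V : Type} {S : Set V} (w : Sym2 S → ℕ) : Sym2 V → ℕ :=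
  Function.extend (Sym2.map Subtype.val) w 0

lemma extendWeight_coe {V : Type} {S : Set V} (w : Sym2 S → ℕ) (x y : S) :
    extendWeight w s(↑x, ↑y) = w s(x, y) :=
  (Sym2.map.injective Subtype.val_injective).extend_apply w 0 s(x, y)

lemma extendWeight_eq_zero {V : Type} {S : Set V} (w : Sym2 S → ℕ) {x y : V} (h : x ∉ S) :
    extendWeight w s(x, y) = 0 := by
  refine Function.extend_apply' _ _ _ ?_
  rintro ⟨e, he⟩
  have hx : x ∈ Sym2.map Subtype.val e := by rw [he]; exact Sym2.mem_mk_left x y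
  obtain ⟨z, -, rfl⟩ := Sym2.mem_map.1 hx
  exact h z.2

/-- Edge-weightings of the components of `G - v` can be combined with an arbitrary set `U` of
edges at `v` receiving weight `1`. -/
lemma exists_glued_weighting {V : Type} [Fintype V] {G : SimpleGraph V} (hG : G.IsTree) (v : V)
    (U : Finset V) (hU : ∀ u ∈ U, G.Adj v u) (W : ∀ u, Sym2 (compSet G v u) → ℕ)
    (hW : ∀ u, G.Adj v u → Is01Weighting (G.induce (compSet G v u)) (W u)) :
    ∃ w, Is01Weighting G w ∧ wdeg G w v = U.card ∧ ∀ u, G.Adj v u → ∀ x : compSet G v u,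
      wdeg G w x = if u ∈ U then wdegPlus (G.induce (compSet G v u)) (W u) (compVert G v u) x
        else wdeg (G.induce (compSet G v u)) (W u) x := by
  set w : Sym2 V → ℕ := fun e => (if ∃ u ∈ U, e = s(v, u) then 1 else 0) +
    ∑ u ∈ Finset.univ.filter (fun u => G.Adj v u), extendWeight (W u) e with hw
  have hwv : ∀ y, w s(v, y) = if y ∈ U then 1 else 0 := by
    intro y
    have h0 : ∑ u ∈ Finset.univ.filter (fun u => G.Adj v u), extendWeight (W u) s(v, y) = 0 :=
      Finset.sum_eq_zero fun u hu =>
        extendWeight_eq_zero _ (notMem_compSet (Finset.mem_filter.1 hu).2)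
    have h1 : (∃ u ∈ U, s(v, y) = s(v, u)) ↔ y ∈ U := by
      simp only [Sym2.eq_iff]
      grind
    simp only [hw, h0, h1, add_zero]
  have hwc : ∀ u, G.Adj v u → ∀ x y : compSet G v u, w s(↑x, ↑y) = W u s(x, y) := by
    intro u hu x y
    have hxv : (x : V) ≠ v := ne_of_mem_compSet hu x.2
    have hyv : (y : V) ≠ v := ne_of_mem_compSet hu y.2
    have h1 : ¬ ∃ u' ∈ U, s((x : V), (y : V)) = s(v, u') := by
      rintro ⟨u', -, h⟩
      rw [Sym2.eq_iff] at h
      tauto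
    simp only [hw, h1, if_false, zero_add]
    rw [Finset.sum_eq_single_of_mem u (by simpa using hu), extendWeight_coe]
    intro u' hu' hne
    refine extendWeight_eq_zero _ fun hx => hne ?_
    exact eq_of_mem_compSet hG.isAcyclic (Finset.mem_filter.1 hu').2 hu hx x.2
  refine ⟨w, ?_, ?_, ?_⟩
  · intro e
    induction e with | _ x y
    intro hxy
    rw [SimpleGraph.mem_edgeSet] at hxy
    by_cases hxv : x = v
    · subst hxv
      rw [hwv]
      split_ifs <;> simp
    by_cases hyv : y = v
    · subst hyv
      rw [Sym2.eq_swap, hwv]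
      split_ifs <;> simp
    obtain ⟨u, hu, hxu⟩ := exists_mem_compSet hG.connected hxv
    have hyu := mem_compSet_of_adj hxu hxy hxv hyv
    rw [hwc u hu ⟨x, hxu⟩ ⟨y, hyu⟩]
    exact hW u hu _ hxy
  · simp only [wdeg, hwv, Finset.sum_boole, Finset.filter_filter, Nat.cast_id]
    congr 1
    ext y
    simp only [Finset.mem_filter, Finset.mem_univ, true_and]
    exact ⟨fun h => h.2, fun h => ⟨hU y h, h⟩⟩
  · intro u hu x
    have hxv : (x : V) ≠ v := ne_of_mem_compSet hu x.2
    have hsplit : ∀ y, (if G.Adj x y then w s(↑x, y) else 0) =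
        (if y ∈ compSet G v u then if G.Adj x y then w s(↑x, y) else 0 else 0) +
          if y = v then if u ∈ U ∧ x = compVert G v u then 1 else 0 else 0 := by
      intro y
      by_cases hyv : y = v
      · subst hyv
        simp only [notMem_compSet hu, if_false, zero_add, if_true]
        have hux : G.Adj x y ↔ (x : V) = u :=
          ⟨fun h => eq_of_mem_compSet hG.isAcyclic h.symm hu (SimpleGraph.Reachable.refl _) x.2,
            fun h => by rw [h]; exact hu.symm⟩
        have hux' : x = compVert G y u ↔ (x : V) = u := Subtype.ext_iff
        rw [Sym2.eq_swap, hwv]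
        by_cases h : (x : V) = u
        · simp [h, hu.symm, hux']
        · simp [hux, hux', h]
      · by_cases hxy : G.Adj x y
        · simp [hyv, mem_compSet_of_adj x.2 hxy hxv hyv]
        · simp [hyv, hxy]
    have hdeg : wdeg G w x = wdeg (G.induce (compSet G v u)) (W u) x +
        if u ∈ U ∧ x = compVert G v u then 1 else 0 := by
      simp only [wdeg]
      rw [Finset.sum_filter, Finset.sum_congr rfl fun y _ => hsplit y, Finset.sum_add_distrib,
        Finset.sum_ite_eq' Finset.univ v, if_pos (Finset.mem_univ v)]
      congr 1
      rw [← Finset.sum_filter, ← Finset.sum_subtype_eq_sum_filter, Finset.sum_filter]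
      refine Finset.sum_congr (by ext; simp) fun y _ => ?_
      rw [← hwc u hu x y]
      simp [SimpleGraph.comap_adj]
    rw [hdeg]
    by_cases huU : u ∈ U
    · simp only [huU, true_and, if_true, wdegPlus]
      congr
    · simp [huU]

/-- A choice of the set `U` of edges at `v` of weight `1`, compatible with the colours available
in the components of `G - v`, gives a weighting of `G` which is proper when the weighted degree
of `v` is increased by `p`. -/
lemma exists_proper_weighting {V : Type} [Fintype V] {G : SimpleGraph V} (hG : G.IsTree) (v : V)
    (p : ℕ) (U : Finset V) (hU : ∀ u ∈ U, G.Adj v u)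
    (h₁ : ∀ u ∈ U, ∃ c ∈ shiftedColours (G.induce (compSet G v u)) (compVert G v u),
      c ≠ U.card + p)
    (h₀ : ∀ u, G.Adj v u → u ∉ U →
      ∃ c ∈ plainColours (G.induce (compSet G v u)) (compVert G v u), c ≠ U.card + p) :
    ∃ w, Is01Weighting G w ∧ wdeg G w v = U.card ∧ ∀ ⦃x y⦄, G.Adj x y →
      wdeg G w x + (if x = v then p else 0) ≠ wdeg G w y + if y = v then p else 0 := by
  have key : ∀ u, ∃ W : Sym2 (compSet G v u) → ℕ, G.Adj v u →
      Is01Weighting (G.induce (compSet G v u)) W ∧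
      (∀ ⦃x y⦄, (G.induce (compSet G v u)).Adj x y →
        (if u ∈ U then wdegPlus (G.induce (compSet G v u)) W (compVert G v u) x
          else wdeg (G.induce (compSet G v u)) W x) ≠
        if u ∈ U then wdegPlus (G.induce (compSet G v u)) W (compVert G v u) y
          else wdeg (G.induce (compSet G v u)) W y) ∧
      (if u ∈ U then wdegPlus (G.induce (compSet G v u)) W (compVert G v u) (compVert G v u)
        else wdeg (G.induce (compSet G v u)) W (compVert G v u)) ≠ U.card + p := by
    intro u
    by_cases hu : G.Adj v u
    · by_cases huU : u ∈ U
      · obtain ⟨c, ⟨W, hW, hp, rfl⟩, hc⟩ := h₁ u huU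
        exact ⟨W, fun _ => ⟨hW, by simpa only [huU, if_true] using hp,
          by simpa [huU, wdegPlus] using hc⟩⟩
      · obtain ⟨c, ⟨W, hW, hp, rfl⟩, hc⟩ := h₀ u hu huU
        exact ⟨W, fun _ => ⟨hW, by simpa only [huU, if_false] using hp, by simpa [huU] using hc⟩⟩
    · exact ⟨0, fun h => absurd h hu⟩
  choose W hW using key
  obtain ⟨w, hw, hwv, hwc⟩ := exists_glued_weighting hG v U hU W fun u hu => (hW u hu).1
  have hnbr : ∀ u, G.Adj v u → wdeg G w u ≠ wdeg G w v + p := by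
    intro u hu
    have h := hwc u hu (compVert G v u)
    rw [hwv]
    exact h ▸ (hW u hu).2.2
  refine ⟨w, hw, hwv, fun x y hxy => ?_⟩
  by_cases hxv : x = v
  · subst hxv
    simpa [hxy.ne'] using (hnbr y hxy).symm
  by_cases hyv : y = v
  · subst hyv
    simpa [hxv] using hnbr x hxy.symm
  obtain ⟨u, hu, hxu⟩ := exists_mem_compSet hG.connected hxv
  have hyu := mem_compSet_of_adj hxu hxy hxv hyv
  have hx := hwc u hu ⟨x, hxu⟩
  have hy := hwc u hu ⟨y, hyu⟩
  simp only [hxv, hyv, if_false, add_zero]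
  dsimp only at hx hy
  rw [hx, hy]
  exact (hW u hu).2.1 hxy

/-! ### The counting argument -/

lemma counting_of_gap_three {N β s : ℕ} {x y : ℕ → ℕ}
    (hx : ∑ e ∈ Finset.range (N + 2), x e ≤ N) (hy : ∑ e ∈ Finset.range (N + 2), y e ≤ N)
    (h₁ : ∀ e, x e ≤ e → e + y e ≤ N → e + β = s)
    (h₂ : ∀ e, x (e + 1) ≤ e → e + y (e + 1) ≤ N → e + 1 + β = s + 3) :
    N = 2 ∧ β = s ∧ x 1 = 2 ∧ y 2 = 2 := by
  rcases lt_or_ge 2 N with hN | hN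
  · exfalso
    have key : ∀ e ∈ Finset.range (N + 2), (3 : ℤ) ≤ x e + y e + ((if e = 0 then 2 else 0) +
        (if e = N + 1 then 2 else 0) + (if e = 1 then 1 else 0) + (if e = N then 1 else 0) +
        (if e + β = s then 1 else 0) + (if e + β = s + 3 then 1 else 0)) := by
      intro e he
      rw [Finset.mem_range] at he
      have a₁ := h₁ e
      rcases Nat.eq_zero_or_pos e with rfl | hpos
      · split_ifs <;> omega
      · obtain ⟨e, rfl⟩ := Nat.exists_eq_succ_of_ne_zero hpos.ne'
        have a₂ := h₂ e
        simp only [Nat.succ_eq_add_one] at *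
        split_ifs <;> omega
    have hle : ∀ k, ∑ e ∈ Finset.range (N + 2), (if e + β = k then (1 : ℤ) else 0) ≤ 1 := by
      intro k
      rw [Finset.sum_ite, Finset.sum_const_zero, add_zero, Finset.sum_const, nsmul_eq_mul, mul_one]
      norm_cast
      refine Finset.card_le_one.2 fun a ha b hb => ?_
      simp only [Finset.mem_filter] at ha hb
      omega
    have total := Finset.sum_le_sum key
    have b₁ := hle s
    have b₂ := hle (s + 3)
    simp only [Finset.sum_add_distrib, Finset.sum_const, Finset.card_range,
      Finset.sum_ite_eq', Finset.mem_range] at total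
    zify at hx hy
    simp only [nsmul_eq_mul, Nat.cast_add, Nat.cast_ofNat] at total
    split_ifs at total <;> omega
  · have a₀ := h₁ 0
    have a₁ := h₁ 1
    have a₂ := h₁ 2
    have b₀ := h₂ 0
    have b₁ := h₂ 1
    have b₂ := h₂ 2
    interval_cases N <;> simp [Finset.sum_range_succ] at hx hy a₀ a₁ a₂ b₀ b₁ b₂ <;> omega

/-- If the components of `G - v` force at most `n` edges at `v` to have weight `1`, and allow at
least `n` edges at `v` to have weight `1`, then some weighting of `G` which is proper when the
weighted degree of `v` is increased by `p` gives `v` the weighted degree `n`. -/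
lemma exists_proper_weighting_of_card_le {V : Type} [Fintype V] {G : SimpleGraph V}
    (hG : G.IsTree) (v : V) (p n : ℕ)
    (h₁ : (Finset.univ.filter fun u => G.Adj v u ∧
      plainColours (G.induce (compSet G v u)) (compVert G v u) ⊆ {n + p}).card ≤ n)
    (h₂ : n ≤ (Finset.univ.filter fun u => G.Adj v u ∧
      ¬ shiftedColours (G.induce (compSet G v u)) (compVert G v u) ⊆ {n + p}).card) :
    ∃ w, Is01Weighting G w ∧ wdeg G w v = n ∧ ∀ ⦃x y⦄, G.Adj x y →
      wdeg G w x + (if x = v then p else 0) ≠ wdeg G w y + if y = v then p else 0 := by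
  obtain ⟨c⟩ := hG.colorable_two
  obtain ⟨U, hU₁, hU₂, rfl⟩ := Finset.exists_subsuperset_card_eq (by
    intro u hu
    simp only [Finset.mem_filter, Finset.mem_univ, true_and] at hu ⊢
    refine ⟨hu.1, fun h => ?_⟩
    obtain ⟨d, hd, hne⟩ := exists_colour_ne (connected_induce_compSet G v u)
      (fun x => c x) (fun x y hxy => c.valid hxy) (compVert G v u) (n + p)
    exact hne (Set.union_subset hu.2 h hd)) h₁ h₂
  refine exists_proper_weighting hG v p U (fun u hu => (Finset.mem_filter.1 (hU₂ hu)).2.1)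
    (fun u hu => ?_) fun u huv hu => ?_
  · have := (Finset.mem_filter.1 (hU₂ hu)).2.2
    simpa [Set.subset_def] using this
  · by_contra! h
    exact hu (hU₁ (by simpa [huv, Set.subset_def] using h))

lemma sum_card_filter_le {ι : Type} (M : Finset ι) (P : ℕ → ι → Prop)
    (hP : ∀ i ∈ M, ∀ a b, P a i → P b i → a = b) (n : ℕ) :
    ∑ e ∈ Finset.range n, (M.filter (P e)).card ≤ M.card := by
  rw [← Finset.card_biUnion]
  · exact Finset.card_le_card (Finset.biUnion_subset.2 fun e _ => Finset.filter_subset _ _)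
  · intro a _ b _ hab
    refine Finset.disjoint_left.2 fun i hi hi' => hab ?_
    rw [Finset.mem_filter] at hi hi'
    exact hP i hi.1 a b hi.2 hi'.2

/-- The counting argument for families of sets of colours, indexed by the neighbours of the
distinguished vertex: `P u` and `Q u` are the plain and shifted colours of `u`. -/
lemma classification_of_gap_three {ι : Type} (A : Finset ι) (P Q : ι → Set ℕ) (s : ℕ)
    (hPQ : ∀ u ∈ A, ∀ n, P u ⊆ {n} → ¬ Q u ⊆ {n})
    (h₁ : ∀ n, (A.filter fun u => P u ⊆ {n}).card ≤ n →
      n ≤ (A.filter fun u => ¬ Q u ⊆ {n}).card → n = s)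
    (h₂ : ∀ n, (A.filter fun u => P u ⊆ {n + 1}).card ≤ n →
      n ≤ (A.filter fun u => ¬ Q u ⊆ {n + 1}).card → n + 1 = s + 3) :
    ∃ M ⊆ A, M.card = 2 ∧ (∀ u ∈ M, P u = {s + 1} ∧ Q u = {s + 2}) ∧
      (A.filter fun u => P u = ∅).card = s ∧ ∀ u ∈ A, u ∉ M → P u ≠ ∅ → Q u = ∅ := by
  set B := A.filter fun u => P u = ∅ with hB
  set M := A.filter fun u => P u ≠ ∅ ∧ Q u ≠ ∅ with hM
  set x : ℕ → ℕ := fun e => (M.filter fun u => P u = {e + B.card}).card with hx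
  set y : ℕ → ℕ := fun e => (M.filter fun u => Q u = {e + B.card}).card with hy
  have hinj : ∀ (S : Set ℕ) (a b : ℕ), S = {a + B.card} → S = {b + B.card} → a = b := by
    rintro S a b h h'
    have := Set.singleton_injective (h.symm.trans h')
    omega
  have hsub : ∀ e n, n = e + B.card → (A.filter fun u => P u ⊆ {n}).card ≤ B.card + x e := by
    rintro e n rfl
    refine le_trans (Finset.card_le_card fun u hu => ?_) (Finset.card_union_le _ _)
    simp only [hB, hM, Finset.mem_union, Finset.mem_filter, Set.subset_singleton_iff_eq] at hu ⊢
    have := hPQ u hu.1 (e + B.card)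
    simp only [Set.subset_singleton_iff_eq] at this
    tauto
  have hsup : ∀ e n, n = e + B.card →
      B.card + M.card ≤ (A.filter fun u => ¬ Q u ⊆ {n}).card + y e := by
    rintro e n rfl
    have hdisj : Disjoint B M := by
      refine Finset.disjoint_left.2 fun u hu hu' => ?_
      rw [hB, Finset.mem_filter] at hu
      rw [hM, Finset.mem_filter] at hu'
      exact hu'.2.1 hu.2
    rw [← Finset.card_union_of_disjoint hdisj]
    refine le_trans (Finset.card_le_card fun u hu => ?_) (Finset.card_union_le _ _)
    simp only [hB, hM, Finset.mem_union, Finset.mem_filter, Set.subset_singleton_iff_eq] at hu ⊢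
    have hA : u ∈ A := by tauto
    have := hPQ u hA (e + B.card)
    simp only [Set.subset_singleton_iff_eq] at this
    tauto
  obtain ⟨hN, hs, hx₁, hy₂⟩ := counting_of_gap_three (N := M.card) (β := B.card) (s := s)
    (x := x) (y := y)
    (sum_card_filter_le M _ (fun u _ a b => hinj (P u) a b) _)
    (sum_card_filter_le M _ (fun u _ a b => hinj (Q u) a b) _)
    (fun e ha hb => h₁ _ (by have := hsub e _ rfl; omega) (by have := hsup e _ rfl; omega))
    (fun e ha hb => by
      have h := h₂ (e + B.card) (by have := hsub (e + 1) (e + B.card + 1) (by omega); omega)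
        (by have := hsup (e + 1) (e + B.card + 1) (by omega); omega)
      omega)
  refine ⟨M, Finset.filter_subset _ _, hN, fun u hu => ⟨?_, ?_⟩, hs, fun u hA hu hP => ?_⟩
  · have := Finset.card_filter_eq_iff.1 (hx₁.trans hN.symm) u hu
    rwa [hs, add_comm] at this
  · have := Finset.card_filter_eq_iff.1 (hy₂.trans hN.symm) u hu
    rwa [hs, add_comm] at this
  · by_contra hQ
    exact hu (Finset.mem_filter.2 ⟨hA, hP, hQ⟩)

/-- Let `s ≥ 0` and let the tree `G` (finite, with an odd number of
vertices) be a `G_v(s,s+3)`-tree. Then the components of `G - v` (each containing a unique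
neighbour of `v`) are classified as follows: exactly two of them, containing neighbours
`v₁ ≠ v₂` of `v`, are a `G_{v₁}(s+1,s+2)`-tree and a `G_{v₂}(s+1,s+2)`-tree respectively;
exactly `s` of them (those containing the neighbours in `B`) are bad trees; and each
remaining component, containing the neighbour `u`, is a `G_u(−)`-tree. -/
theorem statement13 {V : Type} [Fintype V] (G : SimpleGraph V) (hG : G.IsTree)
    (hodd : Odd (Fintype.card V)) (v : V) (s : ℕ) (h : GvAB G v s (s + 3)) :
    ∃ v₁ v₂ : V, G.Adj v v₁ ∧ G.Adj v v₂ ∧ v₁ ≠ v₂ ∧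
      GvAB (G.induce (compSet G v v₁)) (compVert G v v₁) (s + 1) (s + 2) ∧
      GvAB (G.induce (compSet G v v₂)) (compVert G v v₂) (s + 1) (s + 2) ∧
      ∃ B : Finset V, (∀ b ∈ B, G.Adj v b) ∧ v₁ ∉ B ∧ v₂ ∉ B ∧ B.card = s ∧
        (∀ b ∈ B, ¬ HasZeroOneProperty (G.induce (compSet G v b))) ∧
        ∀ u : V, G.Adj v u → u ≠ v₁ → u ≠ v₂ → u ∉ B →
          GvMinus (G.induce (compSet G v u)) (compVert G v u) := by
  rw [gvAB_iff] at h
  obtain ⟨M, hMA, hM, hMc, hB, hrest⟩ := classification_of_gap_three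
    (Finset.univ.filter fun u => G.Adj v u)
    (fun u => plainColours (G.induce (compSet G v u)) (compVert G v u))
    (fun u => shiftedColours (G.induce (compSet G v u)) (compVert G v u)) s
    (fun u _ n hP hQ => by
      obtain ⟨c⟩ := hG.colorable_two
      obtain ⟨d, hd, hne⟩ := exists_colour_ne (connected_induce_compSet G v u)
        (fun x => c x) (fun x y hxy => c.valid hxy) (compVert G v u) n
      exact hne (Set.union_subset hP hQ hd))
    (fun n h₁ h₂ => by
      rw [Finset.filter_filter] at h₁ h₂
      obtain ⟨w, hw, rfl, hp⟩ := exists_proper_weighting_of_card_le hG v 0 n h₁ h₂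
      exact h.1 ⟨w, hw, by simpa using hp, rfl⟩)
    (fun n h₁ h₂ => by
      rw [Finset.filter_filter] at h₁ h₂
      obtain ⟨w, hw, rfl, hp⟩ := exists_proper_weighting_of_card_le hG v 1 n h₁ h₂
      exact h.2 ⟨w, hw, hp, rfl⟩)
  obtain ⟨v₁, v₂, hne, rfl⟩ := Finset.card_eq_two.1 hM
  have hv₁ : v₁ ∈ ({v₁, v₂} : Finset V) := by simp
  have hv₂ : v₂ ∈ ({v₁, v₂} : Finset V) := by simp
  refine ⟨v₁, v₂, (Finset.mem_filter.1 (hMA hv₁)).2, (Finset.mem_filter.1 (hMA hv₂)).2, hne,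
    (gvAB_iff ..).2 ⟨(hMc _ hv₁).1.subset, (hMc _ hv₁).2.subset⟩,
    (gvAB_iff ..).2 ⟨(hMc _ hv₂).1.subset, (hMc _ hv₂).2.subset⟩, _,
    fun b hb => (Finset.mem_filter.1 (Finset.mem_filter.1 hb).1).2, fun hb => ?_, fun hb => ?_, hB,
    fun b hb => not_hasZeroOneProperty (Finset.mem_filter.1 hb).2, fun u hu hu₁ hu₂ hb => ?_⟩
  · have := (Finset.mem_filter.1 hb).2
    simp [(hMc _ hv₁).1] at this
  · have := (Finset.mem_filter.1 hb).2
    simp [(hMc _ hv₂).1] at this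
  · refine gvMinus_of_shiftedColours_eq_empty (hrest u (by simpa using hu) (by simp [hu₁, hu₂]) ?_)
    exact fun hP => hb (Finset.mem_filter.2 ⟨by simpa using hu, hP⟩)
end
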